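/- arXiv:2211.14973 — 4 statements merged into one kernel-verified Lean document; each statement's English description precedes it below -/
import Mathlib

section
/- For every integer n >= 11 and every number of players p >= 4, no player has a winning strategy in the p-player Tribonacci game on n. -/
/-- The Tribonacci numbers: `T 1 = 1`, `T 2 = 2`, `T 3 = 4`,
`T (i+1) = T i + T (i-1) + T (i-2)` for `i ≥ 3`. -/
def trib : ℕ → ℕ
  | 0 => 0
  | 1 => 1
  | 2 => 2
  | 3 => 4
  | (i + 4) => trib (i + 3) + trib (i + 2) + trib (i + 1)

/-- A legal move of the Tribonacci game, as a relation between the position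
before and the position after the move (positions are multisets of naturals). -/
def TribMove (A B : Multiset ℕ) : Prop :=
  (∃ i, 3 ≤ i ∧ ({trib (i - 2), trib (i - 1), trib i} : Multiset ℕ) ≤ A ∧
      B = A - {trib (i - 2), trib (i - 1), trib i} + {trib (i + 1)}) ∨
  (({1, 1, 2} : Multiset ℕ) ≤ A ∧ B = A - {1, 1, 2} + {4}) ∨
  (({1, 1} : Multiset ℕ) ≤ A ∧ B = A - {1, 1} + {2}) ∨
  (({2, 2} : Multiset ℕ) ≤ A ∧ B = A - {2, 2} + {4}) ∨
  (({4, 4} : Multiset ℕ) ≤ A ∧ B = A - {4, 4} + {7, 1}) ∨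
  (∃ i, 3 < i ∧ ({trib i, trib i} : Multiset ℕ) ≤ A ∧
      B = A - {trib i, trib i} + {trib (i + 1), trib (i - 3)})

/-- A position is terminal when no legal move remains. -/
def Terminal (Move : Multiset ℕ → Multiset ℕ → Prop) (pos : Multiset ℕ) : Prop :=
  ∀ B, ¬ Move pos B

/-- `AllianceWins Move p team t pos`: in the `p`-player game with move relation `Move`,
where players `1, …, p` move cyclically (the mover of the `t`-th move, counting from `t = 0`,
is player `t % p + 1`) and the side making the last legal move wins, the alliance
(set of players) `team` can guarantee, from position `pos` with `t` moves already made,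
that one of its members makes the last move, no matter how the other players play. -/
inductive AllianceWins (Move : Multiset ℕ → Multiset ℕ → Prop) (p : ℕ) (team : ℕ → Prop) :
    ℕ → Multiset ℕ → Prop
  | endMove (t : ℕ) (pos B : Multiset ℕ) (hturn : team (t % p + 1)) (hmove : Move pos B)
      (hterm : Terminal Move B) : AllianceWins Move p team t pos
  | contMove (t : ℕ) (pos B : Multiset ℕ) (hturn : team (t % p + 1)) (hmove : Move pos B)
      (hwin : AllianceWins Move p team (t + 1) B) : AllianceWins Move p team t pos
  | oppMove (t : ℕ) (pos : Multiset ℕ) (hturn : ¬ team (t % p + 1))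
      (hex : ∃ B, Move pos B)
      (hall : ∀ B, Move pos B → AllianceWins Move p team (t + 1) B) :
      AllianceWins Move p team t pos

/-- Player `m` has a winning strategy in the `p`-player game on `n`
(played from `n` copies of `1`, with player 1 moving first). -/
def PlayerWins (Move : Multiset ℕ → Multiset ℕ → Prop) (p m n : ℕ) : Prop :=
  AllianceWins Move p (fun q => q = m) 0 (Multiset.replicate n 1)

/-- The same position cannot be winning for player `m` at two times with different residues. -/
theorem wins_unique (Move : Multiset ℕ → Multiset ℕ → Prop) (p m : ℕ) (t : ℕ) (P : Multiset ℕ)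
    (h : AllianceWins Move p (fun q => q = m) t P) :
    ∀ s, AllianceWins Move p (fun q => q = m) s P → s % p = t % p := by
  have step : ∀ a b : ℕ, (a + 1) % p = (b + 1) % p → a % p = b % p := fun a b hab =>
    Nat.ModEq.add_right_cancel' 1 hab
  have noterm : ∀ s B, Terminal Move B → ¬ AllianceWins Move p (fun q => q = m) s B := by
    intro s B hB hw
    cases hw with
    | endMove _ _ C h1 h2 h3 => exact hB _ h2
    | contMove _ _ C h1 h2 h3 => exact hB _ h2
    | oppMove _ _ h1 h2 h3 => exact hB _ h2.choose_spec
  induction h with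
  | endMove t P B hturn hmove hterm =>
    intro s hs
    by_contra hne
    have hs' : ¬ (s % p + 1 = m) := by intro h; apply hne; exact Nat.add_right_cancel (h.trans hturn.symm)
    cases hs with
    | endMove _ _ C h1 h2 h3 => exact hs' h1
    | contMove _ _ C h1 h2 h3 => exact hs' h1
    | oppMove _ _ h1 h2 h3 => exact noterm _ _ hterm (h3 _ hmove)
  | contMove t P B hturn hmove hwin ih =>
    intro s hs
    by_contra hne
    have hs' : ¬ (s % p + 1 = m) := by intro h; apply hne; exact Nat.add_right_cancel (h.trans hturn.symm)
    cases hs with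
    | endMove _ _ C h1 h2 h3 => exact hs' h1
    | contMove _ _ C h1 h2 h3 => exact hs' h1
    | oppMove _ _ h1 h2 h3 => exact hne (step _ _ (ih _ (h3 _ hmove)))
  | oppMove t P hturn hex hall ih =>
    intro s hs
    cases hs with
    | endMove _ _ C h1 h2 h3 => exact absurd (hall _ h2) (noterm _ _ h3)
    | contMove _ _ C h1 h2 h3 => exact step _ _ (ih _ h2 _ h3)
    | oppMove _ _ h1 h2 h3 =>
      obtain ⟨B, hB⟩ := hex
      exact step _ _ (ih _ hB _ (h3 _ hB))

theorem wins_opp {Move : Multiset ℕ → Multiset ℕ → Prop} {p m t : ℕ} {P B : Multiset ℕ}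
    (h : AllianceWins Move p (fun q => q = m) t P) (ht : t % p + 1 ≠ m) (hm : Move P B) :
    AllianceWins Move p (fun q => q = m) (t + 1) B := by
  cases h with
  | endMove _ _ C h1 h2 h3 => exact absurd h1 ht
  | contMove _ _ C h1 h2 h3 => exact absurd h1 ht
  | oppMove _ _ h1 h2 h3 => exact h3 _ hm

theorem move11 (R : Multiset ℕ) : TribMove ({1, 1} + R) ({2} + R) :=
  Or.inr (Or.inr (Or.inl ⟨Multiset.le_add_right _ _, by
    rw [add_tsub_cancel_left, add_comm]⟩))

theorem move112 (R : Multiset ℕ) : TribMove ({1, 1, 2} + R) ({4} + R) :=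
  Or.inr (Or.inl ⟨Multiset.le_add_right _ _, by
    rw [add_tsub_cancel_left, add_comm]⟩)

theorem move22 (R : Multiset ℕ) : TribMove ({2, 2} + R) ({4} + R) :=
  Or.inr (Or.inr (Or.inr (Or.inl ⟨Multiset.le_add_right _ _, by
    rw [add_tsub_cancel_left, add_comm]⟩)))

/-- Three consecutive opponents and four ones suffice to refute a winning strategy. -/
theorem three_opp {p m t : ℕ} {P : Multiset ℕ} (hp : 4 ≤ p) (hc : 4 ≤ P.count 1)
    (h0 : t % p + 1 ≠ m) (h1 : (t + 1) % p + 1 ≠ m) (h2 : (t + 2) % p + 1 ≠ m) :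
    ¬ AllianceWins TribMove p (fun q => q = m) t P := by
  intro h
  obtain ⟨R, rfl⟩ := Multiset.le_iff_exists_add.mp (Multiset.le_count_iff_replicate_le.mp hc)
  have e0 : Multiset.replicate 4 1 + R = {1, 1} + ({1, 1} + R) := by
    rw [← add_assoc]; rfl
  rw [e0] at h
  have a1 := wins_opp h h0 (move11 _)
  have e1 : ({2} : Multiset ℕ) + ({1, 1} + R) = {1, 1, 2} + R := by
    rw [← add_assoc]; congr 1; decide
  have e2 : ({2} : Multiset ℕ) + ({1, 1} + R) = {1, 1} + ({2} + R) := by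
    rw [add_left_comm]
  have e3 : ({2} : Multiset ℕ) + ({2} + R) = {2, 2} + R := by
    rw [← add_assoc]; rfl
  have a2 := wins_opp (e1 ▸ a1) h1 (move112 _)
  have b2 := wins_opp (e2 ▸ a1) h1 (move11 _)
  have b3 := wins_opp (e3 ▸ b2) h2 (move22 _)
  have := wins_unique _ _ _ _ _ a2 _ b3
  have h3 : (1 : ℕ) ≡ 0 [MOD p] := by
    apply Nat.ModEq.add_left_cancel' (t + 1 + 1)
    exact this
  have h4 : 1 % p = 0 % p := h3
  rw [Nat.mod_eq_of_lt (by omega), Nat.zero_mod] at h4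
  omega

theorem trib_ne_one (i : ℕ) (hi : 3 ≤ i) : trib i ≠ 1 := by
  have pos : ∀ j, 0 < trib (j + 1) ∧ 0 < trib (j + 2) ∧ 0 < trib (j + 3) := by
    intro j
    induction j with
    | zero => decide
    | succ k ih => refine ⟨ih.2.1, ih.2.2, ?_⟩; show 0 < trib (k + 4); rw [trib]; omega
  obtain ⟨j, rfl⟩ := Nat.exists_eq_add_of_le' hi
  cases j with
  | zero => decide
  | succ k => have := pos k; show trib (k + 4) ≠ 1; rw [trib]; omega

theorem count_move {A B : Multiset ℕ} (h : TribMove A B) : A.count 1 ≤ B.count 1 + 2 := by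
  have key : ∀ C D : Multiset ℕ, C.count 1 ≤ 2 → B = A - C + D → A.count 1 ≤ B.count 1 + 2 := by
    rintro C D hC rfl
    rw [Multiset.count_add, Multiset.count_sub]
    omega
  have pair : ∀ a b : ℕ, ({a, b} : Multiset ℕ).count 1 ≤ 2 := fun a b =>
    (Multiset.count_le_card 1 _).trans (by simp)
  rcases h with ⟨i, hi, -, h⟩ | ⟨-, h⟩ | ⟨-, h⟩ | ⟨-, h⟩ | ⟨-, h⟩ | ⟨i, hi, -, h⟩
  · refine key _ _ ?_ h
    have e : ({trib (i - 2), trib (i - 1), trib i} : Multiset ℕ)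
        = {trib (i - 2), trib (i - 1)} + {trib i} := rfl
    rw [e, Multiset.count_add, Multiset.count_singleton, if_neg (trib_ne_one i hi).symm]
    exact pair _ _
  · exact key _ _ (by decide) h
  all_goals exact key _ _ (pair _ _) h

theorem wins_step {p m t : ℕ} {P : Multiset ℕ}
    (h : AllianceWins TribMove p (fun q => q = m) t P) (hc : 4 ≤ P.count 1) :
    ∃ B, AllianceWins TribMove p (fun q => q = m) (t + 1) B ∧ P.count 1 ≤ B.count 1 + 2 := by
  cases h with
  | endMove _ _ B h1 h2 h3 =>
    exfalso
    have := count_move h2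
    have h4 : 2 ≤ B.count 1 := by omega
    obtain ⟨R, rfl⟩ := Multiset.le_iff_exists_add.mp (Multiset.le_count_iff_replicate_le.mp h4)
    exact h3 _ (move11 R)
  | contMove _ _ B h1 h2 h3 => exact ⟨B, h3, count_move h2⟩
  | oppMove _ _ h1 h2 h3 =>
    obtain ⟨B, hB⟩ := h2
    exact ⟨B, h3 _ hB, count_move hB⟩

theorem turn_aux {p m j : ℕ} (hp : 4 ≤ p) (h1 : 1 ≤ m) (hj : j ≤ 2) (hm : m ≤ 3) :
    (m + j) % p + 1 ≠ m := by
  rcases lt_or_ge (m + j) p with h | h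
  · rw [Nat.mod_eq_of_lt h]; omega
  · rw [Nat.mod_eq_sub_mod h, Nat.mod_eq_of_lt (by omega)]; omega

/-- For every integer `n ≥ 11` and every number of players `p ≥ 4`, no player has a
winning strategy in the `p`-player Tribonacci game on `n`. -/
theorem multiplayer_tribonacci_no_winner_of_four_players (n p : ℕ) (hn : 11 ≤ n) (hp : 4 ≤ p) :
    ∀ m, 1 ≤ m → m ≤ p → ¬ PlayerWins TribMove p m n := by
  intro m h1 hm h
  unfold PlayerWins at h
  have c0 : (Multiset.replicate n 1).count 1 = n := Multiset.count_replicate_self 1 n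
  by_cases hm4 : 4 ≤ m
  · refine three_opp hp (by omega) ?_ ?_ ?_ h <;> rw [Nat.mod_eq_of_lt (by omega)] <;> omega
  · have hm3 : m ≤ 3 := by omega
    have a0 := turn_aux (j := 0) hp h1 (by omega) hm3
    have a1 := turn_aux (j := 1) hp h1 (by omega) hm3
    have a2 := turn_aux (j := 2) hp h1 (by omega) hm3
    obtain ⟨B1, w1, c1⟩ := wins_step h (by omega)
    obtain ⟨B2, w2, c2⟩ := wins_step w1 (by omega)
    obtain ⟨B3, w3, c3⟩ := wins_step w2 (by omega)
    obtain rfl | rfl | rfl : m = 1 ∨ m = 2 ∨ m = 3 := by omega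
    · exact three_opp hp (by omega) a0 a1 a2 w1
    · exact three_opp hp (by omega) a0 a1 a2 w2
    · exact three_opp hp (by omega) a0 a1 a2 w3
end

section
/- For every integer n >= 7 and every number of players p >= 3, no player has a winning strategy in the p-player Tribonacci game on n. -/
/-- The position with `a` ones, `b` twos, `c` fours and `d` sevens. -/
def TribPos (a b c d : ℕ) : Multiset ℕ :=
  Multiset.replicate a 1 + Multiset.replicate b 2 + Multiset.replicate c 4 +
    Multiset.replicate d 7

theorem TribPos.split (a b c d a' b' c' d' : ℕ) :
    TribPos (a + a') (b + b') (c + c') (d + d') = TribPos a b c d + TribPos a' b' c' d' := by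
  simp only [TribPos, Multiset.replicate_add]
  abel

theorem TribPos.sub (a b c d a' b' c' d' : ℕ) :
    TribPos (a + a') (b + b') (c + c') (d + d') - TribPos a' b' c' d' = TribPos a b c d := by
  rw [TribPos.split, add_tsub_cancel_right]

theorem TribPos.le (a b c d a' b' c' d' : ℕ) :
    TribPos a' b' c' d' ≤ TribPos (a + a') (b + b') (c + c') (d + d') := by
  rw [TribPos.split]
  exact Multiset.le_add_left _ _

theorem TribPos.of_le {a b c d a' b' c' d' : ℕ} (h : TribPos a' b' c' d' ≤ TribPos a b c d) :
    a' ≤ a ∧ b' ≤ b ∧ c' ≤ c ∧ d' ≤ d := by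
  have h1 := Multiset.count_le_of_le 1 h
  have h2 := Multiset.count_le_of_le 2 h
  have h4 := Multiset.count_le_of_le 4 h
  have h7 := Multiset.count_le_of_le 7 h
  simp [TribPos, Multiset.count_replicate] at h1 h2 h4 h7
  exact ⟨h1, h2, h4, h7⟩

theorem TribPos.mem_le {a b c d x : ℕ} (h : x ∈ TribPos a b c d) : x ≤ 7 := by
  simp only [TribPos, Multiset.mem_add, Multiset.mem_replicate] at h
  omega

theorem e112 : ({1, 1, 2} : Multiset ℕ) = TribPos 2 1 0 0 := by decide
theorem e11 : ({1, 1} : Multiset ℕ) = TribPos 2 0 0 0 := by decide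
theorem e22 : ({2, 2} : Multiset ℕ) = TribPos 0 2 0 0 := by decide
theorem e44 : ({4, 4} : Multiset ℕ) = TribPos 0 0 2 0 := by decide
theorem e77 : ({7, 7} : Multiset ℕ) = TribPos 0 0 0 2 := by decide
theorem e124 : ({1, 2, 4} : Multiset ℕ) = TribPos 1 1 1 0 := by decide
theorem e247 : ({2, 4, 7} : Multiset ℕ) = TribPos 0 1 1 1 := by decide
theorem e71 : ({7, 1} : Multiset ℕ) = TribPos 1 0 0 1 := by decide
theorem e2 : ({2} : Multiset ℕ) = TribPos 0 1 0 0 := by decide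
theorem e4 : ({4} : Multiset ℕ) = TribPos 0 0 1 0 := by decide
theorem e7 : ({7} : Multiset ℕ) = TribPos 0 0 0 1 := by decide

theorem trib_big (i : ℕ) (h : 5 ≤ i) : 7 < trib i := by
  induction i, h using Nat.le_induction with
  | base => decide
  | succ i hi ih =>
    obtain ⟨k, rfl⟩ := Nat.exists_eq_add_of_le hi
    have : trib (5 + k + 1) = trib (k + 5) + trib (k + 4) + trib (k + 3) := by
      rw [show 5 + k + 1 = (k + 2) + 4 by omega, trib]
    rw [show 5 + k = k + 5 by omega] at ih
    omega

theorem trib_le_seven {i : ℕ} (h : trib i ≤ 7) : i ≤ 4 := by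
  by_contra hc
  have := trib_big i (by omega)
  omega

theorem move11_s4 (a b c d : ℕ) : TribMove (TribPos (a + 2) b c d) (TribPos a (b + 1) c d) := by
  refine Or.inr (Or.inr (Or.inl ⟨?_, ?_⟩))
  · rw [e11]; exact TribPos.le a b c d 2 0 0 0
  · have := TribPos.sub a b c d 2 0 0 0
    simp only [add_zero] at this
    rw [e11, e2, this]; exact TribPos.split a b c d 0 1 0 0

theorem move112_s4 (a b c d : ℕ) :
    TribMove (TribPos (a + 2) (b + 1) c d) (TribPos a b (c + 1) d) := by
  refine Or.inr (Or.inl ⟨?_, ?_⟩)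
  · rw [e112]; exact TribPos.le a b c d 2 1 0 0
  · have := TribPos.sub a b c d 2 1 0 0
    simp only [add_zero] at this
    rw [e112, e4, this]; exact TribPos.split a b c d 0 0 1 0

theorem move22_s4 (a b c d : ℕ) : TribMove (TribPos a (b + 2) c d) (TribPos a b (c + 1) d) := by
  refine Or.inr (Or.inr (Or.inr (Or.inl ⟨?_, ?_⟩)))
  · rw [e22]; exact TribPos.le a b c d 0 2 0 0
  · have := TribPos.sub a b c d 0 2 0 0
    simp only [add_zero] at this
    rw [e22, e4, this]; exact TribPos.split a b c d 0 0 1 0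

theorem move44 (a b c d : ℕ) :
    TribMove (TribPos a b (c + 2) d) (TribPos (a + 1) b c (d + 1)) := by
  refine Or.inr (Or.inr (Or.inr (Or.inr (Or.inl ⟨?_, ?_⟩))))
  · rw [e44]; exact TribPos.le a b c d 0 0 2 0
  · have := TribPos.sub a b c d 0 0 2 0
    simp only [add_zero] at this
    rw [e44, e71, this]; exact TribPos.split a b c d 1 0 0 1

theorem move124 (a b c d : ℕ) :
    TribMove (TribPos (a + 1) (b + 1) (c + 1) d) (TribPos a b c (d + 1)) := by
  refine Or.inl ⟨3, le_rfl, ?_, ?_⟩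
  · rw [show ({trib (3 - 2), trib (3 - 1), trib 3} : Multiset ℕ) = TribPos 1 1 1 0 from e124]
    exact TribPos.le a b c d 1 1 1 0
  · have := TribPos.sub a b c d 1 1 1 0
    simp only [add_zero] at this
    rw [show ({trib (3 - 2), trib (3 - 1), trib 3} : Multiset ℕ) = TribPos 1 1 1 0 from e124,
      show ({trib (3 + 1)} : Multiset ℕ) = TribPos 0 0 0 1 from e7, this]
    exact TribPos.split a b c d 0 0 0 1

/-- All moves from a position with at most one seven, and none if there are fours. -/
theorem moves_of {a b c d : ℕ} {B : Multiset ℕ} (hd : d ≤ 1) (hcd : c = 0 ∨ d = 0)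
    (h : TribMove (TribPos a b c d) B) :
    (∃ a' b' c', a = a' + 1 ∧ b = b' + 1 ∧ c = c' + 1 ∧ B = TribPos a' b' c' (d + 1)) ∨
    (∃ a' b', a = a' + 2 ∧ b = b' + 1 ∧ B = TribPos a' b' (c + 1) d) ∨
    (∃ a', a = a' + 2 ∧ B = TribPos a' (b + 1) c d) ∨
    (∃ b', b = b' + 2 ∧ B = TribPos a b' (c + 1) d) ∨
    (∃ c', c = c' + 2 ∧ B = TribPos (a + 1) b c' (d + 1)) := by
  rcases h with ⟨i, hi, hle, rfl⟩ | ⟨hle, rfl⟩ | ⟨hle, rfl⟩ | ⟨hle, rfl⟩ | ⟨hle, rfl⟩ |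
    ⟨i, hi, hle, rfl⟩
  · have hm : trib i ∈ TribPos a b c d := Multiset.mem_of_le hle (by simp)
    have hi4 := trib_le_seven (TribPos.mem_le hm)
    obtain rfl | rfl : i = 3 ∨ i = 4 := by omega
    · rw [show ({trib (3 - 2), trib (3 - 1), trib 3} : Multiset ℕ) = TribPos 1 1 1 0 from e124]
        at hle ⊢
      rw [show ({trib (3 + 1)} : Multiset ℕ) = TribPos 0 0 0 1 from e7]
      obtain ⟨ha, hb, hc, -⟩ := TribPos.of_le hle
      obtain ⟨a, rfl⟩ := Nat.exists_eq_add_of_le' ha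
      obtain ⟨b, rfl⟩ := Nat.exists_eq_add_of_le' hb
      obtain ⟨c, rfl⟩ := Nat.exists_eq_add_of_le' hc
      refine Or.inl ⟨a, b, c, rfl, rfl, rfl, ?_⟩
      have := TribPos.sub a b c d 1 1 1 0
      simp only [add_zero] at this
      rw [this]; exact (TribPos.split a b c d 0 0 0 1).symm
    · rw [show ({trib (4 - 2), trib (4 - 1), trib 4} : Multiset ℕ) = TribPos 0 1 1 1 from e247]
        at hle
      obtain ⟨ha, hb, hc, hd⟩ := TribPos.of_le hle
      omega
  · rw [e112] at hle ⊢
    obtain ⟨ha, hb, -, -⟩ := TribPos.of_le hle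
    obtain ⟨a, rfl⟩ := Nat.exists_eq_add_of_le' ha
    obtain ⟨b, rfl⟩ := Nat.exists_eq_add_of_le' hb
    refine Or.inr (Or.inl ⟨a, b, rfl, rfl, ?_⟩)
    have := TribPos.sub a b c d 2 1 0 0
    simp only [add_zero] at this
    rw [this, e4]; exact (TribPos.split a b c d 0 0 1 0).symm
  · rw [e11] at hle ⊢
    obtain ⟨ha, -, -, -⟩ := TribPos.of_le hle
    obtain ⟨a, rfl⟩ := Nat.exists_eq_add_of_le' ha
    refine Or.inr (Or.inr (Or.inl ⟨a, rfl, ?_⟩))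
    have := TribPos.sub a b c d 2 0 0 0
    simp only [add_zero] at this
    rw [this, e2]; exact (TribPos.split a b c d 0 1 0 0).symm
  · rw [e22] at hle ⊢
    obtain ⟨-, hb, -, -⟩ := TribPos.of_le hle
    obtain ⟨b, rfl⟩ := Nat.exists_eq_add_of_le' hb
    refine Or.inr (Or.inr (Or.inr (Or.inl ⟨b, rfl, ?_⟩)))
    have := TribPos.sub a b c d 0 2 0 0
    simp only [add_zero] at this
    rw [this, e4]; exact (TribPos.split a b c d 0 0 1 0).symm
  · rw [e44] at hle ⊢
    obtain ⟨-, -, hc, -⟩ := TribPos.of_le hle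
    obtain ⟨c, rfl⟩ := Nat.exists_eq_add_of_le' hc
    refine Or.inr (Or.inr (Or.inr (Or.inr ⟨c, rfl, ?_⟩)))
    have := TribPos.sub a b c d 0 0 2 0
    simp only [add_zero] at this
    rw [this, e71]; exact (TribPos.split a b c d 1 0 0 1).symm
  · have hm : trib i ∈ TribPos a b c d := Multiset.mem_of_le hle (by simp)
    have hi4 := trib_le_seven (TribPos.mem_le hm)
    obtain rfl : i = 4 := by omega
    rw [show ({trib 4, trib 4} : Multiset ℕ) = TribPos 0 0 0 2 from e77] at hle
    obtain ⟨ha, hb, hc, hd⟩ := TribPos.of_le hle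
    omega

section game
variable {Move : Multiset ℕ → Multiset ℕ → Prop} {p : ℕ} {team : ℕ → Prop}

theorem not_wins_terminal {t : ℕ} {pos : Multiset ℕ} (h : AllianceWins Move p team t pos)
    (ht : Terminal Move pos) : False := by
  cases h with
  | endMove _ _ B hturn hmove hterm => exact ht _ hmove
  | contMove _ _ B hturn hmove hwin => exact ht _ hmove
  | oppMove _ _ hturn hex hall => obtain ⟨B, hB⟩ := hex; exact ht _ hB

theorem opp_step {t : ℕ} {pos B : Multiset ℕ} (h : AllianceWins Move p team t pos)
    (hn : ¬ team (t % p + 1)) (hm : Move pos B) : AllianceWins Move p team (t + 1) B := by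
  cases h with
  | endMove _ _ B hturn hmove hterm => exact absurd hturn hn
  | contMove _ _ B hturn hmove hwin => exact absurd hturn hn
  | oppMove _ _ hturn hex hall => exact hall _ hm

theorem own_step {t : ℕ} {pos : Multiset ℕ} (h : AllianceWins Move p team t pos)
    (hn : team (t % p + 1)) :
    ∃ B, Move pos B ∧ (Terminal Move B ∨ AllianceWins Move p team (t + 1) B) := by
  cases h with
  | endMove _ _ B hturn hmove hterm => exact ⟨B, hmove, Or.inl hterm⟩
  | contMove _ _ B hturn hmove hwin => exact ⟨B, hmove, Or.inr hwin⟩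
  | oppMove _ _ hturn hex hall => exact absurd hn hturn

/-- Two sides with disjoint turns cannot both win. -/
theorem wins_exclusive {t : ℕ} {pos : Multiset ℕ} (h : AllianceWins Move p team t pos) :
    ∀ t', AllianceWins Move p team t' pos →
      (∀ k, team ((t + k) % p + 1) → ¬ team ((t' + k) % p + 1)) → False := by
  induction h with
  | endMove t pos B hturn hmove hterm =>
    intro t' h' hk
    exact not_wins_terminal (opp_step h' (hk 0 hturn) hmove) hterm
  | contMove t pos B hturn hmove hwin ih =>
    intro t' h' hk
    refine ih (t' + 1) (opp_step h' (hk 0 hturn) hmove) fun k => ?_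
    have := hk (k + 1)
    rwa [show t + (k + 1) = t + 1 + k by omega, show t' + (k + 1) = t' + 1 + k by omega] at this
  | oppMove t pos hturn hex hall ih =>
    intro t' h' hk
    have hk' : ∀ k, team ((t + 1 + k) % p + 1) → ¬ team ((t' + 1 + k) % p + 1) := fun k => by
      have := hk (k + 1)
      rwa [show t + (k + 1) = t + 1 + k by omega,
        show t' + (k + 1) = t' + 1 + k by omega] at this
    by_cases hteam : team (t' % p + 1)
    · obtain ⟨B, hB, hT | hW⟩ := own_step h' hteam
      · exact not_wins_terminal (hall B hB) hT
      · exact ih B hB (t' + 1) hW hk'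
    · obtain ⟨B, hB⟩ := hex
      exact ih B hB (t' + 1) (opp_step h' hteam hB) hk'

end game

theorem no_consecutive {Move : Multiset ℕ → Multiset ℕ → Prop} {p m t : ℕ} {pos : Multiset ℕ}
    (hp : 3 ≤ p) (h : AllianceWins Move p (fun q => q = m) t pos)
    (h' : AllianceWins Move p (fun q => q = m) (t + 1) pos) : False := by
  refine wins_exclusive h (t + 1) h' fun k h1 h2 => ?_
  have h3 : t + k ≡ t + k + 1 [MOD p] := by
    unfold Nat.ModEq
    rw [show t + k + 1 = t + 1 + k by omega]
    omega
  have h4 := (Nat.modEq_iff_dvd' (by omega)).1 h3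
  rw [show t + k + 1 - (t + k) = 1 by omega] at h4
  have := Nat.le_of_dvd one_pos h4
  omega

/-- Strategy stealing: two consecutive opponents in a position containing `1, 1, 2`. -/
theorem steal {p m t a b c d : ℕ} (hp : 3 ≤ p)
    (h : AllianceWins TribMove p (fun q => q = m) t (TribPos (a + 2) (b + 1) c d))
    (h1 : t % p + 1 ≠ m) (h2 : (t + 1) % p + 1 ≠ m) : False :=
  no_consecutive hp (opp_step h h1 (move112_s4 a b c d))
    (opp_step (opp_step h h1 (move11_s4 a (b + 1) c d)) h2 (move22_s4 a b c d))

theorem terminal_7 (a b d : ℕ) (ha : a ≤ 1) (hb : b ≤ 1) (hd : d ≤ 1) :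
    Terminal TribMove (TribPos a b 0 d) := by
  intro B hB
  rcases moves_of hd (Or.inl rfl) hB with ⟨_, _, _, _, _, _, _⟩ | ⟨_, _, _, _, _⟩ | ⟨_, _, _⟩ |
    ⟨_, _, _⟩ | ⟨_, _, _⟩ <;> omega

/-- For every integer `n ≥ 7` and every number of players `p ≥ 3`, no player has a
winning strategy in the `p`-player Tribonacci game on `n`. -/
theorem multiplayer_tribonacci_no_winner (n p : ℕ) (hn : 7 ≤ n) (hp : 3 ≤ p) :
    ∀ m, 1 ≤ m → m ≤ p → ¬ PlayerWins TribMove p m n := by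
  intro m hm1 hmp hw
  obtain ⟨k, rfl⟩ := Nat.exists_eq_add_of_le' hn
  have h0 : AllianceWins TribMove p (fun q => q = m) 0 (TribPos (k + 7) 0 0 0) := by
    have : TribPos (k + 7) 0 0 0 = Multiset.replicate (k + 7) 1 := by simp [TribPos]
    rw [this]; exact hw
  have m0 : 0 % p = 0 := Nat.zero_mod p
  have m1 : 1 % p = 1 := Nat.mod_eq_of_lt (by omega)
  have m2 : 2 % p = 2 := Nat.mod_eq_of_lt (by omega)
  have m3 : 3 % p = 0 ∧ p = 3 ∨ 3 % p = 3 ∧ 3 < p := by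
    rcases hp.eq_or_lt with rfl | h
    · simp
    · right; exact ⟨Nat.mod_eq_of_lt h, h⟩
  have h1 : AllianceWins TribMove p (fun q => q = m) 1 (TribPos (k + 5) 1 0 0) := by
    by_cases hm : m = 1
    · obtain ⟨B, hB, hor⟩ := own_step h0 (by omega)
      have hBe : B = TribPos (k + 5) 1 0 0 := by
        rcases moves_of (by omega) (by omega) hB with ⟨_, _, _, _, _, _, _⟩ | ⟨_, _, _, _, _⟩ |
          ⟨a', ha, hB⟩ | ⟨_, _, _⟩ | ⟨_, _, _⟩ <;> try omega
        obtain rfl : a' = k + 5 := by omega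
        exact hB
      subst hBe
      rcases hor with hT | hW
      · exact absurd (move11_s4 (k + 3) 1 0 0) (hT _)
      · exact hW
    · exact opp_step h0 (by omega) (move11_s4 (k + 5) 0 0 0)
  -- players `1` and `m ≥ 4`
  by_cases hm : m = 2 ∨ m = 3
  swap
  · exact steal (a := k + 3) (b := 0) hp h1 (by omega) (by simp only [Nat.reduceAdd]; omega)
  rcases hm with rfl | rfl
  · -- player 2
    obtain ⟨B, hB, hor⟩ := own_step h1 (by omega)
    have hB2 : B = TribPos (k + 3) 2 0 0 ∨ B = TribPos (k + 3) 0 1 0 := by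
      rcases moves_of (by omega) (by omega) hB with ⟨_, _, _, _, _, _, _⟩ | ⟨a', b', ha, hb, hB⟩ |
        ⟨a', ha, hB⟩ | ⟨_, _, _⟩ | ⟨_, _, _⟩ <;> try omega
      · obtain rfl : a' = k + 3 := by omega
        obtain rfl : b' = 0 := by omega
        exact Or.inr hB
      · obtain rfl : a' = k + 3 := by omega
        exact Or.inl hB
    rcases hB2 with rfl | rfl
    · rcases hor with hT | hW
      · exact hT _ (move11_s4 (k + 1) 2 0 0)
      · exact steal (a := k + 1) (b := 1) hp hW (by simp only [Nat.reduceAdd]; omega)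
          (by simp only [Nat.reduceAdd]; omega)
    rcases hor with hT | h2
    · exact hT _ (move11_s4 (k + 1) 0 1 0)
    simp only [Nat.reduceAdd] at h2
    have h3 := opp_step h2 (by omega) (move11_s4 (k + 1) 0 1 0)
    simp only [Nat.reduceAdd] at h3
    have h4 := opp_step h3 (by omega) (move124 k 0 0 0)
    simp only [Nat.reduceAdd] at h4
    have hk : k ≤ 1 ∨ 2 ≤ k := by omega
    rcases hk with hk | hk
    · exact not_wins_terminal h4 (terminal_7 k 0 1 hk (by omega) (by omega))
    rcases m3 with ⟨-, rfl⟩ | ⟨m3, hp4⟩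
    swap
    · obtain ⟨j, rfl⟩ := Nat.exists_eq_add_of_le' hk
      refine steal (a := j + 1) (b := 0) hp h3 (by omega) ?_
      rcases (show p = 4 ∨ 4 < p by omega) with rfl | h
      · simp
      · simp only [Nat.reduceAdd]; rw [Nat.mod_eq_of_lt h]; omega
    -- three players, player 2 moves at time 4
    rcases (show k = 2 ∨ k = 3 ∨ 4 ≤ k by omega) with rfl | rfl | hk4
    · have g4 := opp_step h3 (by simp) (move112_s4 1 0 1 0)
      obtain ⟨B, hB, hor⟩ := own_step g4 (by simp)
      have hBe : B = TribPos 2 0 0 1 := by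
        rcases moves_of (by omega) (by omega) hB with ⟨_, _, _, _, _, _, _⟩ | ⟨_, _, _, _, _⟩ |
          ⟨_, _, _⟩ | ⟨_, _, _⟩ | ⟨c', hc, hB⟩ <;> try omega
        obtain rfl : c' = 0 := by omega
        exact hB
      subst hBe
      rcases hor with hT | hW
      · exact hT _ (move11_s4 0 0 0 1)
      · exact not_wins_terminal (opp_step hW (by simp) (move11_s4 0 0 0 1))
          (terminal_7 0 1 1 (by omega) (by omega) (by omega))
    · have g4 := opp_step h3 (by simp) (move112_s4 2 0 1 0)
      obtain ⟨B, hB, hor⟩ := own_step g4 (by simp)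
      have hBe : B = TribPos 3 0 0 1 ∨ B = TribPos 0 1 2 0 := by
        rcases moves_of (by omega) (by omega) hB with ⟨_, _, _, _, _, _, _⟩ | ⟨_, _, _, _, _⟩ |
          ⟨a', ha, hB⟩ | ⟨_, _, _⟩ | ⟨c', hc, hB⟩ <;> try omega
        · obtain rfl : a' = 0 := by omega
          exact Or.inr hB
        · obtain rfl : c' = 0 := by omega
          exact Or.inl hB
      rcases hBe with rfl | rfl
      · rcases hor with hT | hW
        · exact hT _ (move11_s4 1 0 0 1)
        · exact not_wins_terminal (opp_step hW (by simp) (move11_s4 1 0 0 1))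
            (terminal_7 1 1 1 (by omega) (by omega) (by omega))
      · rcases hor with hT | hW
        · exact hT _ (move44 0 1 0 0)
        · exact not_wins_terminal (opp_step hW (by simp) (move44 0 1 0 0))
            (terminal_7 1 1 1 (by omega) (by omega) (by omega))
    · obtain ⟨j, rfl⟩ := Nat.exists_eq_add_of_le' hk4
      obtain ⟨B, hB, hor⟩ := own_step h4 (by simp)
      have hBe : B = TribPos (j + 2) 1 0 1 := by
        rcases moves_of (by omega) (by omega) hB with ⟨_, _, _, _, _, _, _⟩ | ⟨_, _, _, _, _⟩ |
          ⟨a', ha, hB⟩ | ⟨_, _, _⟩ | ⟨_, _, _⟩ <;> try omega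
        obtain rfl : a' = j + 2 := by omega
        exact hB
      subst hBe
      rcases hor with hT | hW
      · exact hT _ (move11_s4 j 1 0 1)
      · exact steal (a := j) (b := 0) hp hW (by simp) (by simp)
  · -- player 3
    have h2 := opp_step h1 (by omega) (move112_s4 (k + 3) 0 0 0)
    simp only [Nat.reduceAdd] at h2
    obtain ⟨B, hB, hor⟩ := own_step h2 (by omega)
    have hBe : B = TribPos (k + 1) 1 1 0 := by
      rcases moves_of (by omega) (by omega) hB with ⟨_, _, _, _, _, _, _⟩ | ⟨_, _, _, _, _⟩ |
        ⟨a', ha, hB⟩ | ⟨_, _, _⟩ | ⟨_, _, _⟩ <;> try omega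
      obtain rfl : a' = k + 1 := by omega
      exact hB
    subst hBe
    rcases hor with hT | h3
    · exact hT _ (move124 k 0 0 0)
    simp only [Nat.reduceAdd] at h3
    rcases (show k = 0 ∨ 1 ≤ k by omega) with rfl | hk
    · exact not_wins_terminal (opp_step h3 (by omega) (move124 0 0 0 0))
        (terminal_7 0 0 1 (by omega) (by omega) (by omega))
    · obtain ⟨j, rfl⟩ := Nat.exists_eq_add_of_le' hk
      refine steal (a := j) (b := 0) hp h3 (by omega) ?_
      simp only [Nat.reduceAdd]
      rcases (show p = 3 ∨ p = 4 ∨ 4 < p by omega) with rfl | rfl | h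
      · simp
      · simp
      · rw [Nat.mod_eq_of_lt h]; omega
end

section
/- In the two-player (c,2)-nacci Zeckendorf game on n, for every c >= 1 and every n >= (c+1)^3 + (c+1): if c is odd then Player 2 has a winning strategy, and if c is even then Player 1 has a winning strategy. -/
/-- The `(c,k)`-nacci numbers: `nacci c k 1 = 1`,
`nacci c k (i+1) = c * (nacci c k i + ⋯ + nacci c k 1) + 1` for `1 ≤ i ≤ k`, and
`nacci c k (i+1) = c * (nacci c k i + ⋯ + nacci c k (i-k))` for `i ≥ k + 1`.
(The value at `0` is junk.) -/
def nacci (c k : ℕ) : ℕ → ℕ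
  | 0 => 0
  | 1 => 1
  | (i + 2) =>
    if i + 1 ≤ k then
      c * ((Finset.range (i + 1)).attach.sum fun j => nacci c k (j.1 + 1)) + 1
    else
      c * ((Finset.Icc (i + 1 - k) (i + 1)).attach.sum fun j => nacci c k j.1)
decreasing_by
  · have hj := j.2
    simp only [Finset.mem_range] at hj
    omega
  · have hj := j.2
    simp only [Finset.mem_Icc] at hj
    omega


/-- The multiset consisting of `c` copies of `nacci c k j` for each `j` in the
finite set `s`. -/
def nacciBlock (c k : ℕ) (s : Finset ℕ) : Multiset ℕ :=
  s.val.bind fun j => Multiset.replicate c (nacci c k j)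

/-- A legal move of the `(c,k)`-nacci Zeckendorf game, as a relation between the
position before and the position after the move (positions are multisets of naturals). -/
def CkMove (c k : ℕ) (A B : Multiset ℕ) : Prop :=
  -- (1) for `i ≥ k+1`: `c` copies each of `S_{i-k}, …, S_i` become `S_{i+1}`
  (∃ i, k + 1 ≤ i ∧ nacciBlock c k (Finset.Icc (i - k) i) ≤ A ∧
    B = A - nacciBlock c k (Finset.Icc (i - k) i) + {nacci c k (i + 1)}) ∨
  -- (2) for `2 ≤ i ≤ k`: `c+1` copies of `S_1` and `c` copies each of `S_2, …, S_i`
  -- become `S_{i+1}`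
  (∃ i, 2 ≤ i ∧ i ≤ k ∧
    Multiset.replicate (c + 1) (nacci c k 1) + nacciBlock c k (Finset.Icc 2 i) ≤ A ∧
    B = A - (Multiset.replicate (c + 1) (nacci c k 1) + nacciBlock c k (Finset.Icc 2 i))
        + {nacci c k (i + 1)}) ∨
  -- (3) `c+1` copies of `S_1` become `S_2`
  (Multiset.replicate (c + 1) (nacci c k 1) ≤ A ∧
    B = A - Multiset.replicate (c + 1) (nacci c k 1) + {nacci c k 2}) ∨
  -- (3) for `1 < i < k+1`: `c+1` copies of `S_i` become `S_{i+1}`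
  (∃ i, 1 < i ∧ i < k + 1 ∧ Multiset.replicate (c + 1) (nacci c k i) ≤ A ∧
    B = A - Multiset.replicate (c + 1) (nacci c k i) + {nacci c k (i + 1)}) ∨
  -- (3) `c+1` copies of `S_{k+1}` become `S_{k+2}` and `S_1`
  (Multiset.replicate (c + 1) (nacci c k (k + 1)) ≤ A ∧
    B = A - Multiset.replicate (c + 1) (nacci c k (k + 1))
        + {nacci c k (k + 2), nacci c k 1}) ∨
  -- (3) for `i > k+1`: `c+1` copies of `S_i` become `S_{i+1}` and `c` copies of `S_{i-k-1}`
  (∃ i, k + 1 < i ∧ Multiset.replicate (c + 1) (nacci c k i) ≤ A ∧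
    B = A - Multiset.replicate (c + 1) (nacci c k i)
        + ({nacci c k (i + 1)} + Multiset.replicate c (nacci c k (i - k - 1))))

theorem nacci_zero (c : ℕ) : nacci c 2 0 = 0 := by rw [nacci]
theorem nacci_one (c : ℕ) : nacci c 2 1 = 1 := by rw [nacci]
theorem nacci_two (c : ℕ) : nacci c 2 2 = c + 1 := by
  rw [nacci, if_pos (by norm_num), Finset.sum_attach (Finset.range (0 + 1)) (fun j => nacci c 2 (j + 1))]
  simp [nacci_one]
theorem nacci_three (c : ℕ) : nacci c 2 3 = c * (1 + (c + 1)) + 1 := by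
  rw [nacci, if_pos (by norm_num), Finset.sum_attach (Finset.range (1 + 1)) (fun j => nacci c 2 (j + 1))]
  simp [Finset.sum_range_succ, nacci_one, nacci_two]

theorem Icc_three (j : ℕ) : Finset.Icc (j + 1) (j + 3) = {j + 1, j + 2, j + 3} := by
  ext x; simp only [Finset.mem_Icc, Finset.mem_insert, Finset.mem_singleton]; omega

theorem nacci_rec (c j : ℕ) :
    nacci c 2 (j + 4) = c * (nacci c 2 (j + 1) + (nacci c 2 (j + 2) + nacci c 2 (j + 3))) := by
  rw [nacci, if_neg (by omega), Finset.sum_attach (Finset.Icc (j + 2 + 1 - 2) (j + 2 + 1)) (fun j => nacci c 2 j)]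
  have : Finset.Icc (j + 2 + 1 - 2) (j + 2 + 1) = {j + 1, j + 2, j + 3} := Icc_three j
  rw [this]
  simp

theorem nacci_lt_succ (c : ℕ) (hc : 1 ≤ c) : ∀ i, nacci c 2 i < nacci c 2 (i + 1)
  | 0 => by simp [nacci_zero, nacci_one]
  | 1 => by simp [nacci_one, nacci_two]; omega
  | 2 => by rw [nacci_two, show 2 + 1 = 3 from rfl, nacci_three]; nlinarith
  | (j + 3) => by
    have h1 := nacci_lt_succ c hc j
    rw [nacci_rec]
    nlinarith

theorem nacci_strictMono (c : ℕ) (hc : 1 ≤ c) : StrictMono (nacci c 2) :=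
  strictMono_nat_of_lt_succ (nacci_lt_succ c hc)

theorem block_three (c j : ℕ) : nacciBlock c 2 (Finset.Icc (j + 1) (j + 3)) =
    Multiset.replicate c (nacci c 2 (j + 1)) + Multiset.replicate c (nacci c 2 (j + 2))
      + Multiset.replicate c (nacci c 2 (j + 3)) := by
  rw [Icc_three, nacciBlock, Finset.insert_val_of_notMem (by simp),
    Finset.insert_val_of_notMem (by simp)]
  simp [add_assoc]

theorem block_two (c : ℕ) : nacciBlock c 2 (Finset.Icc 2 2) =
    Multiset.replicate c (nacci c 2 2) := by
  simp [nacciBlock]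

/-- Termination measure: each `S_i` weighs `i + 1`. -/
noncomputable def wt (c : ℕ) (A : Multiset ℕ) : ℕ :=
  (A.map fun v => Function.invFun (nacci c 2) v + 1).sum

theorem wt_add (c : ℕ) (A B : Multiset ℕ) : wt c (A + B) = wt c A + wt c B := by simp [wt]

theorem inv_nacci (c : ℕ) (hc : 1 ≤ c) (i : ℕ) : Function.invFun (nacci c 2) (nacci c 2 i) = i :=
  Function.leftInverse_invFun (nacci_strictMono c hc).injective i

theorem wt_replicate (c : ℕ) (hc : 1 ≤ c) (m i : ℕ) :
    wt c (Multiset.replicate m (nacci c 2 i)) = m * (i + 1) := by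
  simp [wt, inv_nacci c hc]

theorem wt_single (c : ℕ) (hc : 1 ≤ c) (i : ℕ) : wt c {nacci c 2 i} = i + 1 := by
  simp [wt, inv_nacci c hc]

theorem wt_pair (c : ℕ) (hc : 1 ≤ c) (i j : ℕ) :
    wt c {nacci c 2 i, nacci c 2 j} = (i + 1) + (j + 1) := by
  simp [wt, inv_nacci c hc]

theorem wt_step (c : ℕ) {A X Y : Multiset ℕ} (h : X ≤ A) (hw : wt c Y < wt c X) :
    wt c (A - X + Y) < wt c A := by
  have : wt c A = wt c (A - X) + wt c X := by rw [← wt_add, Multiset.sub_add_cancel h]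
  rw [wt_add, this]; omega

theorem move_wt (c : ℕ) (hc : 1 ≤ c) {A B : Multiset ℕ} (h : CkMove c 2 A B) :
    wt c B < wt c A := by
  rcases h with ⟨i, hi, hX, rfl⟩ | ⟨i, hi, hi', hX, rfl⟩ | ⟨hX, rfl⟩ | ⟨i, hi, hi', hX, rfl⟩ |
    ⟨hX, rfl⟩ | ⟨i, hi, hX, rfl⟩ <;> apply wt_step c hX
  · obtain ⟨j, rfl⟩ := Nat.exists_eq_add_of_le' hi
    have : j + (2 + 1) - 2 = j + 1 := by omega
    rw [this]
    change _ < wt c (nacciBlock c 2 (Finset.Icc (j + 1) (j + 3)))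
    rw [block_three]
    simp only [wt_add, wt_single c hc, wt_replicate c hc]
    nlinarith
  · obtain rfl : i = 2 := by omega
    simp only [block_two, wt_add, wt_single c hc, wt_replicate c hc]
    omega
  · simp only [wt_single c hc, wt_replicate c hc]
    omega
  · simp only [wt_single c hc, wt_replicate c hc]
    nlinarith
  · simp only [wt_pair c hc, wt_replicate c hc]
    omega
  · obtain ⟨j, rfl⟩ := Nat.exists_eq_add_of_lt hi
    have : 2 + 1 + j + 1 - 2 - 1 = j + 1 := by omega
    simp only [this, wt_add, wt_single c hc, wt_replicate c hc]
    nlinarith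

/-- There is a predicate "the player to move wins". -/
theorem exists_W (c : ℕ) (hc : 1 ≤ c) : ∃ W : Multiset ℕ → Prop,
    ∀ A, W A ↔ ∃ B, CkMove c 2 A B ∧ ¬ W B := by
  have wf : WellFounded fun A B : Multiset ℕ => wt c A < wt c B :=
    (measure (wt c)).wf
  refine ⟨wf.fix fun A ih => ∃ B, ∃ h : CkMove c 2 A B, ¬ ih B (move_wt c hc h), fun A => ?_⟩
  rw [wf.fix_eq]
  simp

theorem alliance_of_W (c : ℕ) (hc : 1 ≤ c) (W : Multiset ℕ → Prop)
    (hW : ∀ A, W A ↔ ∃ B, CkMove c 2 A B ∧ ¬ W B) (m : ℕ) (hm : m = 1 ∨ m = 2)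
    (A : Multiset ℕ) : ∀ t : ℕ,
      (t % 2 + 1 = m → W A → AllianceWins (CkMove c 2) 2 (fun q => q = m) t A) ∧
      (t % 2 + 1 ≠ m → ¬ W A → (∃ B, CkMove c 2 A B) →
        AllianceWins (CkMove c 2) 2 (fun q => q = m) t A) := by
  induction h : wt c A using Nat.strong_induction_on generalizing A with
  | _ N ih =>
    subst h
    intro t
    constructor
    · intro ht hA
      obtain ⟨B, hB, hWB⟩ := (hW A).1 hA
      by_cases hterm : Terminal (CkMove c 2) B
      · exact .endMove t A B ht hB hterm
      · refine .contMove t A B ht hB ((ih _ (move_wt c hc hB) B rfl (t + 1)).2 (by omega) hWB ?_)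
        simpa [Terminal] using hterm
    · intro ht hA hex
      refine .oppMove t A ht hex fun B hB => (ih _ (move_wt c hc hB) B rfl (t + 1)).1 (by omega) ?_
      by_contra hWB
      exact hA ((hW A).2 ⟨B, hB, hWB⟩)

/-- `a` copies of `S_1`, `b` of `S_2`, `d` of `S_3`, `e` of `S_4`. -/
def pos (c a b d e : ℕ) : Multiset ℕ :=
  Multiset.replicate a (nacci c 2 1) + Multiset.replicate b (nacci c 2 2)
    + Multiset.replicate d (nacci c 2 3) + Multiset.replicate e (nacci c 2 4)

theorem count_pos (c : ℕ) (hc : 1 ≤ c) (a b d e i : ℕ) : (pos c a b d e).count (nacci c 2 i) =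
    (if i = 1 then a else 0) + (if i = 2 then b else 0) + (if i = 3 then d else 0)
      + (if i = 4 then e else 0) := by
  simp only [pos, Multiset.count_add, Multiset.count_replicate,
    (nacci_strictMono c hc).injective.eq_iff, eq_comm]

theorem pos_add (c a b d e a' b' d' e' : ℕ) :
    pos c (a + a') (b + b') (d + d') (e + e') = pos c a b d e + pos c a' b' d' e' := by
  simp only [pos, Multiset.replicate_add]
  abel

/-- Rewriting `pos` after a replacement. -/
theorem pos_replace (c a b d e x1 x2 x3 x4 y1 y2 y3 y4 : ℕ) (h1 : x1 ≤ a) (h2 : x2 ≤ b)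
    (h3 : x3 ≤ d) (h4 : x4 ≤ e) :
    pos c x1 x2 x3 x4 ≤ pos c a b d e ∧
    pos c a b d e - pos c x1 x2 x3 x4 + pos c y1 y2 y3 y4 =
      pos c (a - x1 + y1) (b - x2 + y2) (d - x3 + y3) (e - x4 + y4) := by
  obtain ⟨a, rfl⟩ := Nat.exists_eq_add_of_le h1
  obtain ⟨b, rfl⟩ := Nat.exists_eq_add_of_le h2
  obtain ⟨d, rfl⟩ := Nat.exists_eq_add_of_le h3
  obtain ⟨e, rfl⟩ := Nat.exists_eq_add_of_le h4
  simp only [Nat.add_sub_cancel_left, pos_add, add_tsub_cancel_left]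
  simp

theorem eX1 (c : ℕ) : nacciBlock c 2 (Finset.Icc (3 - 2) 3) = pos c c c c 0 := by
  rw [show 3 - 2 = 0 + 1 from rfl, show Finset.Icc (0 + 1) 3 = Finset.Icc (0 + 1) (0 + 3) from rfl,
    block_three]
  simp [pos]
theorem eX2 (c : ℕ) : Multiset.replicate (c + 1) (nacci c 2 1) + nacciBlock c 2 (Finset.Icc 2 2)
    = pos c (c + 1) c 0 0 := by
  rw [block_two]; simp [pos]
theorem eR1 (c m : ℕ) : Multiset.replicate m (nacci c 2 1) = pos c m 0 0 0 := by simp [pos]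
theorem eR2 (c m : ℕ) : Multiset.replicate m (nacci c 2 2) = pos c 0 m 0 0 := by simp [pos]
theorem eR3 (c m : ℕ) : Multiset.replicate m (nacci c 2 3) = pos c 0 0 m 0 := by simp [pos]
theorem eS2 (c : ℕ) : {nacci c 2 2} = pos c 0 1 0 0 := by simp [pos]
theorem eS3 (c : ℕ) : {nacci c 2 3} = pos c 0 0 1 0 := by simp [pos]
theorem eS4 (c : ℕ) : {nacci c 2 4} = pos c 0 0 0 1 := by simp [pos]
theorem eS41 (c : ℕ) : {nacci c 2 4, nacci c 2 1} = pos c 1 0 0 1 := by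
  simp only [pos, Multiset.replicate_zero, Multiset.replicate_one, add_zero]
  rw [add_comm]; rfl

section moves
variable (c a b d e : ℕ)

theorem mv1 (ha : c + 1 ≤ a) : CkMove c 2 (pos c a b d e) (pos c (a - (c + 1)) (b + 1) d e) := by
  have := pos_replace c a b d e (c + 1) 0 0 0 0 1 0 0 ha (Nat.zero_le _) (Nat.zero_le _) (Nat.zero_le _)
  refine Or.inr (Or.inr (Or.inl ?_))
  rw [eR1, eS2, this.2]
  exact ⟨this.1, by simp⟩

theorem mv2 (ha : c + 1 ≤ a) (hb : c ≤ b) :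
    CkMove c 2 (pos c a b d e) (pos c (a - (c + 1)) (b - c) (d + 1) e) := by
  have := pos_replace c a b d e (c + 1) c 0 0 0 0 1 0 ha hb (Nat.zero_le _) (Nat.zero_le _)
  refine Or.inr (Or.inl ⟨2, le_rfl, le_rfl, ?_⟩)
  rw [eX2, eS3, this.2]
  exact ⟨this.1, by simp⟩

theorem mv3 (hb : c + 1 ≤ b) :
    CkMove c 2 (pos c a b d e) (pos c a (b - (c + 1)) (d + 1) e) := by
  have := pos_replace c a b d e 0 (c + 1) 0 0 0 0 1 0 (Nat.zero_le _) hb (Nat.zero_le _) (Nat.zero_le _)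
  refine Or.inr (Or.inr (Or.inr (Or.inl ⟨2, by norm_num, by norm_num, ?_⟩)))
  rw [eR2, eS3, this.2]
  exact ⟨this.1, by simp⟩

theorem mv4 (ha : c ≤ a) (hb : c ≤ b) (hd : c ≤ d) :
    CkMove c 2 (pos c a b d e) (pos c (a - c) (b - c) (d - c) (e + 1)) := by
  have := pos_replace c a b d e c c c 0 0 0 0 1 ha hb hd (Nat.zero_le _)
  refine Or.inl ⟨3, by norm_num, ?_⟩
  rw [eX1, eS4, this.2]
  exact ⟨this.1, by simp⟩

theorem mv5 (hd : c + 1 ≤ d) :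
    CkMove c 2 (pos c a b d e) (pos c (a + 1) b (d - (c + 1)) (e + 1)) := by
  have := pos_replace c a b d e 0 0 (c + 1) 0 1 0 0 1 (Nat.zero_le _) (Nat.zero_le _) hd (Nat.zero_le _)
  refine Or.inr (Or.inr (Or.inr (Or.inr (Or.inl ?_))))
  rw [eR3, eS41, this.2]
  exact ⟨this.1, by simp⟩

/-- The complete list of moves when few copies of `S_4` are present. -/
theorem move_cases (hc : 1 ≤ c) (he : e ≤ c) (hbe : b < c ∨ e < c) {B : Multiset ℕ}
    (h : CkMove c 2 (pos c a b d e) B) :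
    B = pos c (a - (c + 1)) (b + 1) d e ∨
    (c ≤ b ∧ B = pos c (a - (c + 1)) (b - c) (d + 1) e) ∨
    (c + 1 ≤ b ∧ B = pos c a (b - (c + 1)) (d + 1) e) ∨
    (c ≤ b ∧ c ≤ d ∧ B = pos c (a - c) (b - c) (d - c) (e + 1)) ∨
    (c + 1 ≤ d ∧ B = pos c (a + 1) b (d - (c + 1)) (e + 1)) := by
  have key : ∀ m i, Multiset.replicate m (nacci c 2 i) ≤ pos c a b d e → m ≤
      (if i = 1 then a else 0) + (if i = 2 then b else 0) + (if i = 3 then d else 0)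
      + (if i = 4 then e else 0) := by
    intro m i h
    rw [← count_pos c hc]
    exact Multiset.le_count_iff_replicate_le.2 h
  rcases h with ⟨i, hi, hX, rfl⟩ | ⟨i, hi, hi', hX, rfl⟩ | ⟨hX, rfl⟩ | ⟨i, hi, hi', hX, rfl⟩ |
    ⟨hX, rfl⟩ | ⟨i, hi, hX, rfl⟩
  · obtain ⟨j, rfl⟩ := Nat.exists_eq_add_of_le' hi
    have hj : j + (2 + 1) - 2 = j + 1 := by omega
    have hX' := hX
    rw [hj, show j + (2 + 1) = j + 3 from rfl, block_three] at hX'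
    have k1 := key _ _ ((Multiset.le_add_right _ _).trans ((Multiset.le_add_right _ _).trans hX'))
    have k2 := key _ _ ((Multiset.le_add_left _ _).trans ((Multiset.le_add_right _ _).trans hX'))
    have k3 := key _ _ ((Multiset.le_add_left _ _).trans hX')
    rcases j with _ | _ | j
    · simp at k1 k2 k3
      have := pos_replace c a b d e c c c 0 0 0 0 1 k1 k2 k3 (Nat.zero_le _)
      refine Or.inr (Or.inr (Or.inr (Or.inl ⟨k2, k3, ?_⟩)))
      simp only [zero_add, Nat.reduceAdd]
      rw [eX1, eS4, this.2]
      simp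
    · simp at k1 k2 k3
      omega
    · simp at k3
      omega
  · obtain rfl : i = 2 := by omega
    have k1 := key _ _ ((Multiset.le_add_right _ _).trans hX)
    rw [block_two] at hX
    have k2 := key _ _ ((Multiset.le_add_left _ _).trans hX)
    simp at k1 k2
    have := pos_replace c a b d e (c + 1) c 0 0 0 0 1 0 k1 k2 (Nat.zero_le _) (Nat.zero_le _)
    refine Or.inr (Or.inl ⟨k2, ?_⟩)
    rw [eX2, eS3, this.2]
    simp
  · have k1 := key _ _ hX
    simp at k1
    have := pos_replace c a b d e (c + 1) 0 0 0 0 1 0 0 k1 (Nat.zero_le _) (Nat.zero_le _) (Nat.zero_le _)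
    left
    rw [eR1, eS2, this.2]
    simp
  · obtain rfl : i = 2 := by omega
    have k2 := key _ _ hX
    simp at k2
    have := pos_replace c a b d e 0 (c + 1) 0 0 0 0 1 0 (Nat.zero_le _) k2 (Nat.zero_le _) (Nat.zero_le _)
    refine Or.inr (Or.inr (Or.inl ⟨k2, ?_⟩))
    rw [eR2, eS3, this.2]
    simp
  · have k3 := key _ _ hX
    simp at k3
    have := pos_replace c a b d e 0 0 (c + 1) 0 1 0 0 1 (Nat.zero_le _) (Nat.zero_le _) k3 (Nat.zero_le _)
    refine Or.inr (Or.inr (Or.inr (Or.inr ⟨k3, ?_⟩)))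
    simp only [Nat.reduceAdd]
    rw [eR3, eS41, this.2]
    simp
  · have k := key _ _ hX
    split_ifs at k <;> omega

end moves

/-- Value of the pieces `S_2, S_3, S_4`. -/
def val (c b d e : ℕ) : ℕ := b * (c + 1) + d * (c + 1) ^ 2 + e * (c * ((c + 1) ^ 2 + (c + 1) + 1))

theorem W_mid (c n : ℕ) (hc : 1 ≤ c) (hn : (c + 1) ^ 3 + (c + 1) ≤ n)
    (W : Multiset ℕ → Prop) (hW : ∀ A, W A ↔ ∃ B, CkMove c 2 A B ∧ ¬ W B) :
    (W (pos c n 0 0 0) ↔ Even c) := by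
  obtain ⟨F, hF⟩ : ∃ F : ℕ → ℕ → ℕ → Prop, ∀ b d e, F b d e = W (pos c (n - val c b d e) b d e) :=
    ⟨_, fun _ _ _ => rfl⟩
  have lose : ∀ {A B}, ¬ W A → CkMove c 2 A B → W B := by
    intro A B hA hB
    by_contra h
    exact hA ((hW A).2 ⟨B, hB, h⟩)
  have v1 : ∀ b d e, val c (b + 1) d e = val c b d e + (c + 1) := by intros; simp only [val]; ring
  have v2 : ∀ b d e, val c b (d + 1) e = val c (b + c) d e + (c + 1) := by
    intros; simp only [val]; ring
  have v4 : ∀ b d e, val c b d (e + 1) = val c (b + c) (d + c) e + c := by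
    intros; simp only [val]; ring
  have v5 : ∀ b d e, val c b d (e + 1) + 1 = val c b (d + (c + 1)) e := by
    intros; simp only [val]; ring
  -- transitions
  have m1 : ∀ b d e, val c b d e + (c + 1) ≤ n → ¬ F b d e → F (b + 1) d e := by
    intro b d e hv h
    rw [hF] at h ⊢
    have := lose h (mv1 c _ b d e (by omega))
    rwa [show n - val c (b + 1) d e = n - val c b d e - (c + 1) by rw [v1]; omega]
  have m2 : ∀ b d e, val c (b + c) d e + (c + 1) ≤ n → ¬ F (b + c) d e → F b (d + 1) e := by
    intro b d e hv h
    rw [hF] at h ⊢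
    have := lose h (mv2 c _ (b + c) d e (by omega) (by omega))
    rw [Nat.add_sub_cancel] at this
    rwa [show n - val c b (d + 1) e = n - val c (b + c) d e - (c + 1) by rw [v2]; omega]
  have m4 : ∀ b d e, val c (b + c) (d + c) e + (c + 1) ≤ n → ¬ F (b + c) (d + c) e →
      F b d (e + 1) := by
    intro b d e hv h
    rw [hF] at h ⊢
    have := lose h (mv4 c _ (b + c) (d + c) e (by omega) (by omega) (by omega))
    rw [Nat.add_sub_cancel, Nat.add_sub_cancel] at this
    rwa [show n - val c b d (e + 1) = n - val c (b + c) (d + c) e - c by rw [v4]; omega]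
  have m5 : ∀ b d e, val c b (d + (c + 1)) e ≤ n → ¬ F b (d + (c + 1)) e → F b d (e + 1) := by
    intro b d e hv h
    rw [hF] at h ⊢
    have := lose h (mv5 c (n - val c b (d + (c + 1)) e) b (d + (c + 1)) e (by omega))
    rw [Nat.add_sub_cancel] at this
    have h5 := v5 b d e
    rwa [show n - val c b d (e + 1) = n - val c b (d + (c + 1)) e + 1 by omega]
  have s1 : ∀ b d e, b < c → d ≤ c → e ≤ c → val c b d e + (c + 1) ≤ n →
      (F b d e ↔ ¬ F (b + 1) d e) := by
    intro b d e hb hd he hv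
    refine ⟨fun h => ?_, fun h => by_contra fun h' => h (m1 b d e hv h')⟩
    rw [hF] at h
    obtain ⟨B, hB, hWB⟩ := (hW _).1 h
    rw [hF, show n - val c (b + 1) d e = n - val c b d e - (c + 1) by rw [v1]; omega]
    rcases move_cases c _ b d e hc he (Or.inl hb) hB with rfl | h | h | h | h
    · exact hWB
    all_goals omega
  -- value bounds
  have vmono : ∀ b b' d d' e, b ≤ b' → d ≤ d' → val c b d e ≤ val c b' d' e := by
    intro b b' d d' e h h'
    simp only [val]; gcongr
  have vcc : val c c c 0 + (c + 1) = (c + 1) ^ 3 := by simp only [val]; ring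
  have vcd : ∀ b d, b ≤ c → d ≤ c → val c b d 0 + (c + 1) ≤ n := by
    intro b d h h'
    have := vmono b c d c 0 h h'
    omega
  have v0 : val c 0 (c + 1) 0 = (c + 1) ^ 3 := by simp only [val]; ring
  have v01 : val c 0 0 1 + 1 = (c + 1) ^ 3 := by simp only [val]; ring
  have v11 : val c 1 (c + 1) 0 = (c + 1) ^ 3 + (c + 1) := by simp only [val]; ring
  have chain : ∀ d, d ≤ c → ∀ j, j ≤ c → (F 0 d 0 ↔ (F j d 0 ↔ Even j)) := by
    intro d hd j
    induction j with
    | zero => simp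
    | succ j ih =>
      intro hj
      rw [ih (by omega), s1 j d 0 (by omega) hd (by omega) (vcd j d (by omega) hd), Nat.even_add_one]
      tauto
  -- `(c, c)` is not losing
  have final : F c c 0 := by
    by_contra h
    have h1 : F 0 (c + 1) 0 := m2 0 c 0 (by simpa using vcd c c le_rfl le_rfl) (by simpa using h)
    have h2 : F 0 0 1 := m4 0 0 0 (by simpa using vcd c c le_rfl le_rfl) (by simpa using h)
    have h3 : ¬ F 1 0 1 := (s1 0 0 1 (by omega) (by omega) hc (by omega)).1 h2
    have h4 : ¬ F 1 (c + 1) 0 := by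
      rw [hF] at h1
      obtain ⟨B, hB, hWB⟩ := (hW _).1 h1
      rcases move_cases c _ 0 (c + 1) 0 hc (by omega) (Or.inl hc) hB with rfl | h | h | h | h
      · rwa [hF, show n - val c 1 (c + 1) 0 = n - val c 0 (c + 1) 0 - (c + 1) by omega]
      · omega
      · omega
      · omega
      · exfalso
        obtain ⟨-, rfl⟩ := h
        apply hWB
        rw [hF] at h2
        rw [show n - val c 0 (c + 1) 0 + 1 = n - val c 0 0 1 by omega]
        simpa using h2
    exact h3 (m5 1 0 0 (by simpa [v11] using hn) (by simpa using h4))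
  have step : ∀ d, d + 1 ≤ c → ¬ F c d 0 → F 0 (d + 1) 0 := fun d hd h =>
    m2 0 d 0 (by simpa using vcd c d le_rfl (by omega)) (by simpa using h)
  have start : F c 0 0 := by
    by_contra h0
    rcases Nat.even_or_odd c with hev | hodd
    · have : ∀ d, 2 * d ≤ c → ¬ F c (2 * d) 0 := by
        intro d
        induction d with
        | zero => intro _; simpa using h0
        | succ d ih =>
          intro hd
          have hd' : 2 * d + 2 ≤ c := by omega
          have h1 := step (2 * d) (by omega) (ih (by omega))
          have h2 : F c (2 * d + 1) 0 := by
            have := (chain (2 * d + 1) (by omega) c le_rfl).1 h1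
            tauto
          have h3 : ¬ F 0 (2 * d + 2) 0 := by
            intro h3
            have h4 : ¬ F 1 (2 * d + 2) 0 :=
              (s1 0 (2 * d + 2) 0 (by omega) hd' (by omega) (vcd _ _ (by omega) hd')).1 h3
            have hv : val c c (2 * d + 1) 0 + (c + 1) ≤ n := vcd _ _ le_rfl (by omega)
            have h5 : ¬ F (c + 1) (2 * d + 1) 0 := by
              rw [hF] at h2
              obtain ⟨B, hB, hWB⟩ := (hW _).1 h2
              rcases move_cases c _ c (2 * d + 1) 0 hc (by omega) (Or.inr (by omega)) hB with
                rfl | h | h | h | h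
              · rwa [hF, show n - val c (c + 1) (2 * d + 1) 0
                  = n - val c c (2 * d + 1) 0 - (c + 1) by rw [v1]; omega]
              · exfalso
                obtain ⟨-, rfl⟩ := h
                apply hWB
                rw [hF] at h3
                have e2 := v2 0 (2 * d + 1) 0
                rw [zero_add] at e2
                rw [show n - val c c (2 * d + 1) 0 - (c + 1) = n - val c 0 (2 * d + 2) 0 by
                  rw [e2]; omega]
                simpa using h3
              all_goals omega
            apply h4
            refine m2 1 (2 * d + 1) 0 ?_ (by rwa [add_comm 1 c])
            have e2 : val c 1 (2 * d + 2) 0 = _ := v2 1 (2 * d + 1) 0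
            have := vcd 1 (2 * d + 2) hc hd'
            omega
          have := (chain (2 * d + 2) hd' c le_rfl)
          rw [show 2 * (d + 1) = 2 * d + 2 by ring]
          tauto
      obtain ⟨k, hk⟩ := hev
      have h := this k (by omega)
      rw [show 2 * k = c by omega] at h
      exact h final
    · have : ∀ d, d ≤ c → ¬ F c d 0 := by
        intro d
        induction d with
        | zero => intro _; exact h0
        | succ d ih =>
          intro hd
          have h1 := step d hd (ih (by omega))
          have := (chain (d + 1) hd c le_rfl).1 h1
          have := Nat.not_even_iff_odd.2 hodd
          tauto
      exact this c le_rfl final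
  have := chain 0 (by omega) c le_rfl
  rw [hF 0 0 0, show n - val c 0 0 0 = n by simp [val]] at this
  tauto

/-- In the two-player `(c,2)`-nacci Zeckendorf game on `n`, for every `c ≥ 1` and every
`n ≥ (c+1)³ + (c+1)`: if `c` is odd then Player 2 has a winning strategy, and if `c` is
even then Player 1 has a winning strategy. -/
theorem two_player_c2_nacci_winner (c n : ℕ) (hc : 1 ≤ c)
    (hn : (c + 1) ^ 3 + (c + 1) ≤ n) :
    (Odd c → PlayerWins (CkMove c 2) 2 2 n) ∧ (Even c → PlayerWins (CkMove c 2) 2 1 n) := by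
  obtain ⟨W, hW⟩ := exists_W c hc
  have h := W_mid c n hc hn W hW
  have hp : pos c n 0 0 0 = Multiset.replicate n 1 := by simp [pos, nacci_one]
  have hex : ∃ B, CkMove c 2 (Multiset.replicate n 1) B := by
    rw [← hp]
    exact ⟨_, mv1 c n 0 0 0 (by omega)⟩
  rw [hp] at h
  constructor
  · intro hodd
    refine (alliance_of_W c hc W hW 2 (Or.inr rfl) _ 0).2 (by norm_num) ?_ hex
    rw [h]
    exact Nat.not_even_iff_odd.2 hodd
  · intro hev
    exact (alliance_of_W c hc W hW 1 (Or.inl rfl) _ 0).1 (by norm_num) (h.2 hev)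
end

section
/- In the two-player (c,k)-nacci Zeckendorf game on n, for every c >= 1, every k >= 3, and every n >= (c+1)^3 + (c+1): if c is odd then Player 2 has a winning strategy, and if c is even then Player 1 has a winning strategy. -/
namespace CkGame

open Multiset

lemma nacci_one (c k : ℕ) : nacci c k 1 = 1 := by rw [nacci]

lemma nacci_low (c k i : ℕ) (hi : 1 ≤ i) (hik : i ≤ k) :
    nacci c k (i + 1) = c * (∑ j ∈ Finset.range i, nacci c k (j + 1)) + 1 := by
  obtain ⟨m, rfl⟩ : ∃ m, i = m + 1 := ⟨i - 1, by omega⟩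
  rw [nacci, if_pos hik, Finset.sum_attach (Finset.range (m + 1)) (fun j => nacci c k (j + 1))]

lemma nacci_high (c k i : ℕ) (hi : k + 1 ≤ i) :
    nacci c k (i + 1) = c * (∑ j ∈ Finset.Icc (i - k) i, nacci c k j) := by
  obtain ⟨m, rfl⟩ : ∃ m, i = m + 1 := ⟨i - 1, by omega⟩
  rw [nacci, if_neg (by omega),
    Finset.sum_attach (Finset.Icc (m + 1 - k) (m + 1)) (fun j => nacci c k j)]

lemma nacci_pow (c k i : ℕ) (hik : i ≤ k) : nacci c k (i + 1) = (c + 1) ^ i := by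
  induction i with
  | zero => simp [nacci_one]
  | succ m ih =>
    rw [nacci_low c k (m + 1) (by omega) hik, Finset.sum_range_succ]
    rcases Nat.eq_zero_or_pos m with rfl | hm
    · simp [nacci_one]
    · have h1 := nacci_low c k m hm (by omega)
      have h2 := ih (by omega)
      rw [h2] at h1 ⊢
      rw [pow_succ]
      nlinarith

lemma nacci_pos (c k : ℕ) (hc : 1 ≤ c) (i : ℕ) (hi : 1 ≤ i) : 0 < nacci c k i := by
  induction i using Nat.strong_induction_on with
  | _ i ih =>
    obtain ⟨m, rfl⟩ : ∃ m, i = m + 1 := ⟨i - 1, by omega⟩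
    rcases Nat.lt_or_ge k m with h | h
    · rw [nacci_high c k m h]
      have h1 := ih m (by omega) (by omega)
      have : nacci c k m ≤ ∑ j ∈ Finset.Icc (m - k) m, nacci c k j :=
        Finset.single_le_sum (f := fun j => nacci c k j) (fun _ _ => Nat.zero_le _)
          (by simp)
      exact Nat.mul_pos hc (by omega)
    · rw [nacci_pow c k m h]; positivity

lemma nacci_lt_succ (c k : ℕ) (hc : 1 ≤ c) (hk : 1 ≤ k) (i : ℕ) (hi : 1 ≤ i) :
    nacci c k i < nacci c k (i + 1) := by
  rcases Nat.lt_or_ge k i with h | h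
  · rw [nacci_high c k i h]
    have h1 := nacci_pos c k hc (i - 1) (by omega)
    have hsub : ({i - 1, i} : Finset ℕ) ⊆ Finset.Icc (i - k) i := by
      intro x hx
      simp only [Finset.mem_insert, Finset.mem_singleton] at hx
      simp only [Finset.mem_Icc]
      omega
    have h2 : ∑ j ∈ ({i - 1, i} : Finset ℕ), nacci c k j
        ≤ ∑ j ∈ Finset.Icc (i - k) i, nacci c k j :=
      Finset.sum_le_sum_of_subset hsub
    rw [Finset.sum_pair (by omega)] at h2
    nlinarith
  · obtain ⟨m, rfl⟩ : ∃ m, i = m + 1 := ⟨i - 1, by omega⟩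
    rw [nacci_pow c k m (by omega), nacci_pow c k (m + 1) h]
    exact Nat.pow_lt_pow_right (by omega) (by omega)

lemma nacci_lt (c k : ℕ) (hc : 1 ≤ c) (hk : 1 ≤ k) (i j : ℕ) (hi : 1 ≤ i) (hij : i < j) :
    nacci c k i < nacci c k j := by
  induction j, hij using Nat.le_induction with
  | base => exact nacci_lt_succ c k hc hk i hi
  | succ j hj ih => exact ih.trans (nacci_lt_succ c k hc hk j (by omega))

lemma nacci_split (c k : ℕ) : 1 ≤ k →
    nacci c k (k + 2) + 1 = (c + 1) * nacci c k (k + 1) := by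
  intro hk
  have h1 := nacci_low c k k hk le_rfl
  have h2 := nacci_high c k (k + 1) le_rfl
  have h3 : ∑ j ∈ Finset.Icc (k + 1 - k) (k + 1), nacci c k j
      = (∑ j ∈ Finset.range k, nacci c k (j + 1)) + nacci c k (k + 1) := by
    rw [← Finset.sum_range_succ (fun j => nacci c k (j + 1)),
      Finset.sum_bij' (fun j _ => j - 1) (fun j _ => j + 1)]
    all_goals simp
    all_goals try omega
    intro a h1 h2
    rw [Nat.sub_add_cancel (by omega)]
  rw [h3] at h2
  show nacci c k (k + 1 + 1) + 1 = _
  rw [h2]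
  nlinarith

lemma nacci_split' (c k i : ℕ) (hi : k + 1 < i) :
    nacci c k (i + 1) + c * nacci c k (i - k - 1) = (c + 1) * nacci c k i := by
  obtain ⟨m, rfl⟩ : ∃ m, i = m + 1 := ⟨i - 1, by omega⟩
  have h1 := nacci_high c k m (by omega)
  have h2 := nacci_high c k (m + 1) (by omega)
  have e1 : ∑ j ∈ Finset.Icc (m - k) m, nacci c k j
      = nacci c k (m - k) + ∑ j ∈ Finset.Icc (m + 1 - k) m, nacci c k j := by
    rw [← Finset.add_sum_Ioc_eq_sum_Icc (by omega)]
    congr 1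
    apply Finset.sum_congr _ (fun _ _ => rfl)
    ext x; simp; omega
  have e2 : ∑ j ∈ Finset.Icc (m + 1 - k) (m + 1), nacci c k j
      = (∑ j ∈ Finset.Icc (m + 1 - k) m, nacci c k j) + nacci c k (m + 1) := by
    rw [Finset.sum_Icc_succ_top (by omega)]
  have e3 : m + 1 - k - 1 = m - k := by omega
  rw [e1] at h1
  rw [e2] at h2
  rw [e3, h2]
  nlinarith

/-! ### Termination -/

/-- Sum of squares. -/
def sq (A : Multiset ℕ) : ℕ := (A.map fun x => x ^ 2).sum

lemma sq_add (A B : Multiset ℕ) : sq (A + B) = sq A + sq B := by simp [sq]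

lemma sq_singleton (x : ℕ) : sq {x} = x ^ 2 := by simp [sq]

lemma sq_replicate (m x : ℕ) : sq (replicate m x) = m * x ^ 2 := by simp [sq]

lemma sq_le (A : Multiset ℕ) : sq A ≤ A.sum ^ 2 := by
  induction A using Multiset.induction_on with
  | empty => simp [sq]
  | cons a s ih =>
    have : sq (a ::ₘ s) = a ^ 2 + sq s := by simp [sq]
    rw [this, sum_cons]
    nlinarith [Nat.zero_le (a * s.sum)]

/-- Termination measure. -/
def meas (A : Multiset ℕ) : ℕ := A.sum ^ 2 - sq A + card A

lemma meas_lt (A R Q : Multiset ℕ) (hR : R ≤ A) (hs : R.sum = Q.sum)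
    (h : (sq R ≤ sq Q ∧ card Q < card R) ∨ (sq R < sq Q ∧ card Q ≤ card R)) :
    meas (A - R + Q) < meas A := by
  obtain ⟨T, rfl⟩ := Multiset.le_iff_exists_add.1 hR
  rw [add_tsub_cancel_left]
  have h1 := sq_le (T + Q)
  have h2 : (T + Q).sum = (R + T).sum := by simp [hs, add_comm]
  unfold meas
  rw [h2] at h1 ⊢
  simp only [sq_add, card_add] at *
  omega

lemma meas_lt_single (A R : Multiset ℕ) (q : ℕ) (hR : R ≤ A) (hs : R.sum = q)
    (h : 2 ≤ card R) : meas (A - R + {q}) < meas A := by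
  apply meas_lt A R _ hR (by simpa using hs)
  left
  refine ⟨?_, by simp only [card_singleton]; omega⟩
  rw [sq_singleton, ← hs]
  exact sq_le R

lemma block_sum (c k : ℕ) (s : Finset ℕ) :
    (nacciBlock c k s).sum = c * ∑ j ∈ s, nacci c k j := by
  rw [nacciBlock, Multiset.sum_bind, Finset.mul_sum]
  simp only [sum_replicate, smul_eq_mul]
  rfl

lemma block_card (c k : ℕ) (s : Finset ℕ) :
    card (nacciBlock c k s) = s.card * c := by
  simp [nacciBlock, Multiset.card_bind, Function.comp_def]

lemma replicate_le_block (c k : ℕ) (s : Finset ℕ) (j : ℕ) (hj : j ∈ s) :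
    replicate c (nacci c k j) ≤ nacciBlock c k s := by
  unfold nacciBlock
  exact Multiset.le_bind s.val hj

lemma sum2 (c k i : ℕ) (h2 : 1 ≤ i) (hik : i ≤ k) :
    (c + 1) + c * ∑ j ∈ Finset.Icc 2 i, nacci c k j = nacci c k (i + 1) := by
  rw [nacci_low c k i h2 hik]
  have : ∑ j ∈ Finset.range i, nacci c k (j + 1)
      = 1 + ∑ j ∈ Finset.Icc 2 i, nacci c k j := by
    obtain ⟨m, rfl⟩ : ∃ m, i = m + 1 := ⟨i - 1, by omega⟩
    rw [Finset.sum_range_succ', nacci_one, add_comm]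
    congr 1
    rw [Finset.sum_bij' (fun j _ => j + 2) (fun j _ => j - 2)]
    all_goals simp
    all_goals try omega
  rw [this]
  ring

lemma move_meas (c k : ℕ) (hc : 1 ≤ c) (hk : 3 ≤ k) (A B : Multiset ℕ)
    (h : CkMove c k A B) : meas B < meas A := by
  rcases h with ⟨i, hi, hA, rfl⟩ | ⟨i, hi, hik, hA, rfl⟩ | ⟨hA, rfl⟩ | ⟨i, hi, hik, hA, rfl⟩ |
    ⟨hA, rfl⟩ | ⟨i, hi, hA, rfl⟩
  · apply meas_lt_single _ _ _ hA
    · rw [block_sum, nacci_high c k i hi]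
    · rw [block_card, Nat.card_Icc]
      have : 2 ≤ i + 1 - (i - k) := by omega
      nlinarith
  · apply meas_lt_single _ _ _ hA
    · rw [sum_add, block_sum, nacci_one, sum_replicate, smul_eq_mul, mul_one,
        sum2 c k i (by omega) hik]
    · simp; omega
  · apply meas_lt_single _ _ _ hA
    · rw [nacci_pow c k 1 (by omega), nacci_one]; simp [add_comm]
    · simp; omega
  · apply meas_lt_single _ _ _ hA
    · obtain ⟨m, rfl⟩ : ∃ m, i = m + 1 := ⟨i - 1, by omega⟩
      rw [nacci_pow c k m (by omega), nacci_pow c k (m + 1) (by omega)]; simp; ring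
    · simp; omega
  · have h1 := nacci_split c k (by omega)
    have h2 : 1 < nacci c k (k + 1) := by
      have := nacci_lt c k hc (by omega) 1 (k + 1) le_rfl (by omega)
      rwa [nacci_one] at this
    apply meas_lt _ _ _ hA
    · rw [sum_replicate, smul_eq_mul, ← h1]; simp [nacci_one]
    · right
      refine ⟨?_, by simp; omega⟩
      rw [sq_replicate]
      have : sq {nacci c k (k + 2), nacci c k 1} = nacci c k (k + 2) ^ 2 + 1 := by
        simp [sq, nacci_one]
      rw [this]
      generalize nacci c k (k + 2) = y at *
      generalize nacci c k (k + 1) = x at *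
      obtain ⟨d, rfl⟩ : ∃ d, x = 2 + d := ⟨x - 2, by omega⟩
      have hy : y = (1 + d) + c * (2 + d) := by nlinarith
      have e1 : y ^ 2 = c ^ 2 * (2 + d) ^ 2 + c * ((2 + d) * (2 + 2 * d)) + (1 + d) ^ 2 := by
        rw [hy]; ring
      have e2 : c * (2 + d) ^ 2 ≤ c ^ 2 * (2 + d) ^ 2 :=
        Nat.mul_le_mul_right _ (by nlinarith)
      have e3 : 1 * (2 + d) ^ 2 ≤ c * ((2 + d) * (2 + 2 * d)) :=
        Nat.mul_le_mul hc (by nlinarith)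
      nlinarith
  · have h1 := nacci_split' c k i hi
    have h2 : nacci c k (i - k - 1) < nacci c k i :=
      nacci_lt c k hc (by omega) _ _ (by omega) (by omega)
    apply meas_lt _ _ _ hA
    · rw [sum_replicate, smul_eq_mul, ← h1]; simp
    · right
      refine ⟨?_, by simp [add_comm]⟩
      rw [sq_replicate, sq_add, sq_singleton, sq_replicate]
      generalize nacci c k (i + 1) = y at *
      generalize nacci c k i = x at *
      generalize nacci c k (i - k - 1) = z at *
      obtain ⟨d, rfl⟩ : ∃ d, x = z + (d + 1) := ⟨x - z - 1, by omega⟩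
      have hy : y = (z + (d + 1)) + c * (d + 1) := by nlinarith
      have : y ^ 2 + c * z ^ 2
          = (c + 1) * (z + (d + 1)) ^ 2 + c * (c + 1) * (d + 1) ^ 2 := by
        rw [hy]; ring
      have : 0 < c * (c + 1) * (d + 1) ^ 2 := by positivity
      omega

/-! ### Outcomes -/

/-- Positions from which the next mover wins. -/
inductive NWin (Move : Multiset ℕ → Multiset ℕ → Prop) : Multiset ℕ → Prop
  | mk (A B : Multiset ℕ) (h : Move A B) (hB : ∀ C, Move B C → NWin Move C) : NWin Move A

/-- Positions from which the previous mover wins. -/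
def PWin (Move : Multiset ℕ → Multiset ℕ → Prop) (A : Multiset ℕ) : Prop :=
  ∀ C, Move A C → NWin Move C

lemma det (Move : Multiset ℕ → Multiset ℕ → Prop)
    (hm : ∀ A B, Move A B → meas B < meas A) (A : Multiset ℕ) :
    PWin Move A ∨ NWin Move A := by
  induction hA : meas A using Nat.strong_induction_on generalizing A with
  | _ m ih =>
    by_cases h : NWin Move A
    · exact Or.inr h
    · left
      intro C hC
      rcases ih _ (hA ▸ hm A C hC) C rfl with h1 | h1
      · exact absurd (NWin.mk A C hC h1) h
      · exact h1

lemma alliance (Move : Multiset ℕ → Multiset ℕ → Prop) (m : ℕ) (hm : m = 1 ∨ m = 2)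
    (A : Multiset ℕ) (h : NWin Move A) :
    ∀ t, t % 2 + 1 = m → AllianceWins Move 2 (fun q => q = m) t A := by
  induction h with
  | mk A B hAB hB ih =>
    intro t ht
    by_cases hT : Terminal Move B
    · exact AllianceWins.endMove t A B ht hAB hT
    · refine AllianceWins.contMove t A B ht hAB ?_
      refine AllianceWins.oppMove (t + 1) B (by omega) ?_ ?_
      · simpa [Terminal] using hT
      · intro C hC
        exact ih C hC (t + 1 + 1) (by omega)

/-! ### The opening positions -/

/-- `s` ones, `a` copies of `S_2`, `b` of `S_3`, `e` of `S_4`. -/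
def pos (c k s a b e : ℕ) : Multiset ℕ :=
  replicate s (nacci c k 1) + replicate a (nacci c k 2) + replicate b (nacci c k 3)
    + replicate e (nacci c k 4)

lemma nacci_inj (c k : ℕ) (hc : 1 ≤ c) (hk : 1 ≤ k) (i j : ℕ) (hi : 1 ≤ i) (hj : 1 ≤ j) :
    nacci c k i = nacci c k j ↔ i = j := by
  refine ⟨fun h => ?_, fun h => by rw [h]⟩
  rcases lt_trichotomy i j with h1 | h1 | h1
  · have := nacci_lt c k hc hk i j hi h1; omega
  · exact h1
  · have := nacci_lt c k hc hk j i hj h1; omega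

lemma count_pos (c k : ℕ) (hc : 1 ≤ c) (hk : 1 ≤ k) (s a b e j : ℕ) (hj : 1 ≤ j) :
    count (nacci c k j) (pos c k s a b e) =
      (if j = 1 then s else 0) + (if j = 2 then a else 0) + (if j = 3 then b else 0)
        + (if j = 4 then e else 0) := by
  simp only [pos, count_add, count_replicate]
  simp only [nacci_inj c k hc hk 1 j le_rfl hj, nacci_inj c k hc hk 2 j (by omega) hj,
    nacci_inj c k hc hk 3 j (by omega) hj, nacci_inj c k hc hk 4 j (by omega) hj]
  simp only [eq_comm]

lemma block_two (c k : ℕ) : nacciBlock c k (Finset.Icc 2 2) = replicate c (nacci c k 2) := by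
  simp [nacciBlock]

lemma block_three (c k : ℕ) : nacciBlock c k (Finset.Icc 2 3)
    = replicate c (nacci c k 2) + replicate c (nacci c k 3) := by
  have : Finset.Icc 2 3 = ({2, 3} : Finset ℕ) := by decide
  rw [this]
  simp [nacciBlock]

lemma sub_help {A R T Q B : Multiset ℕ} (h : A = R + T) (hB : T + Q = B) :
    R ≤ A ∧ A - R + Q = B := by
  subst h
  rw [add_tsub_cancel_left]
  exact ⟨Multiset.le_add_right _ _, hB⟩

lemma eqU (c k s a b e : ℕ) :
    replicate (c + 1) (nacci c k 1) ≤ pos c k (s + (c + 1)) a b e ∧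
    pos c k (s + (c + 1)) a b e - replicate (c + 1) (nacci c k 1) + {nacci c k 2}
      = pos c k s (a + 1) b e := by
  apply sub_help (T := pos c k s a b e)
  · simp only [pos, replicate_add]; ac_rfl
  · simp only [pos, replicate_add, replicate_one]; ac_rfl

lemma eqC (c k s a b e : ℕ) :
    replicate (c + 1) (nacci c k 1) + nacciBlock c k (Finset.Icc 2 2)
      ≤ pos c k (s + (c + 1)) (a + c) b e ∧
    pos c k (s + (c + 1)) (a + c) b e
      - (replicate (c + 1) (nacci c k 1) + nacciBlock c k (Finset.Icc 2 2)) + {nacci c k (2 + 1)}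
      = pos c k s a (b + 1) e := by
  rw [block_two]
  apply sub_help (T := pos c k s a b e)
  · simp only [pos, replicate_add]; ac_rfl
  · simp only [pos, replicate_add, replicate_one]; ac_rfl

lemma eqD (c k s a b e : ℕ) :
    replicate (c + 1) (nacci c k 1) + nacciBlock c k (Finset.Icc 2 3)
      ≤ pos c k (s + (c + 1)) (a + c) (b + c) e ∧
    pos c k (s + (c + 1)) (a + c) (b + c) e
      - (replicate (c + 1) (nacci c k 1) + nacciBlock c k (Finset.Icc 2 3)) + {nacci c k (3 + 1)}
      = pos c k s a b (e + 1) := by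
  rw [block_three]
  apply sub_help (T := pos c k s a b e)
  · simp only [pos, replicate_add]; ac_rfl
  · simp only [pos, replicate_add, replicate_one]; ac_rfl

lemma eqM (c k s a b e : ℕ) :
    replicate (c + 1) (nacci c k 2) ≤ pos c k s (a + (c + 1)) b e ∧
    pos c k s (a + (c + 1)) b e - replicate (c + 1) (nacci c k 2) + {nacci c k (2 + 1)}
      = pos c k s a (b + 1) e := by
  apply sub_help (T := pos c k s a b e)
  · simp only [pos, replicate_add]; ac_rfl
  · simp only [pos, replicate_add, replicate_one]; ac_rfl

lemma eqE (c k s a b e : ℕ) :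
    replicate (c + 1) (nacci c k 3) ≤ pos c k s a (b + (c + 1)) e ∧
    pos c k s a (b + (c + 1)) e - replicate (c + 1) (nacci c k 3) + {nacci c k (3 + 1)}
      = pos c k s a b (e + 1) := by
  apply sub_help (T := pos c k s a b e)
  · simp only [pos, replicate_add]; ac_rfl
  · simp only [pos, replicate_add, replicate_one]; ac_rfl

lemma moveU (c k s a b e : ℕ) :
    CkMove c k (pos c k (s + (c + 1)) a b e) (pos c k s (a + 1) b e) :=
  Or.inr (Or.inr (Or.inl ⟨(eqU c k s a b e).1, (eqU c k s a b e).2.symm⟩))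

lemma moveC (c k s a b e : ℕ) (hk : 3 ≤ k) :
    CkMove c k (pos c k (s + (c + 1)) (a + c) b e) (pos c k s a (b + 1) e) :=
  Or.inr (Or.inl ⟨2, le_rfl, by omega, (eqC c k s a b e).1, (eqC c k s a b e).2.symm⟩)

lemma moveD (c k s a b e : ℕ) (hk : 3 ≤ k) :
    CkMove c k (pos c k (s + (c + 1)) (a + c) (b + c) e) (pos c k s a b (e + 1)) :=
  Or.inr (Or.inl ⟨3, by omega, by omega, (eqD c k s a b e).1, (eqD c k s a b e).2.symm⟩)

lemma moveM (c k s a b e : ℕ) (hk : 3 ≤ k) :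
    CkMove c k (pos c k s (a + (c + 1)) b e) (pos c k s a (b + 1) e) :=
  Or.inr (Or.inr (Or.inr (Or.inl
    ⟨2, by omega, by omega, (eqM c k s a b e).1, (eqM c k s a b e).2.symm⟩)))

lemma moveE (c k s a b e : ℕ) (hk : 3 ≤ k) :
    CkMove c k (pos c k s a (b + (c + 1)) e) (pos c k s a b (e + 1)) :=
  Or.inr (Or.inr (Or.inr (Or.inl
    ⟨3, by omega, by omega, (eqE c k s a b e).1, (eqE c k s a b e).2.symm⟩)))

lemma le_count {m x : ℕ} {R A : Multiset ℕ} (h1 : replicate m x ≤ R) (h2 : R ≤ A) :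
    m ≤ count x A :=
  Multiset.le_count_iff_replicate_le.2 (h1.trans h2)

lemma move_cases (c k : ℕ) (hc : 1 ≤ c) (hk : 3 ≤ k) (s a b e : ℕ) (he : e ≤ 1)
    (hae : e = 0 ∨ a = 0) (B : Multiset ℕ) (h : CkMove c k (pos c k s a b e) B) :
    (∃ s', s = s' + (c + 1) ∧ B = pos c k s' (a + 1) b e) ∨
    (∃ s' a', s = s' + (c + 1) ∧ a = a' + c ∧ B = pos c k s' a' (b + 1) e) ∨
    (c ≤ a ∧ c ≤ b) ∨ (c + 1 ≤ a) ∨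
    (∃ b', b = b' + (c + 1) ∧ B = pos c k s a b' (e + 1)) := by
  have hcount := count_pos c k hc (by omega) s a b e
  rcases h with ⟨i, hi, hA, rfl⟩ | ⟨i, hi, hik, hA, rfl⟩ | ⟨hA, rfl⟩ | ⟨i, hi, hik, hA, rfl⟩ |
    ⟨hA, rfl⟩ | ⟨i, hi, hA, rfl⟩
  · exfalso
    have h1 := le_count (replicate_le_block c k _ i (by simp)) hA
    rw [hcount i (by omega)] at h1
    have hi4 : i = 4 := by
      by_contra hne
      rw [if_neg (by omega), if_neg (by omega), if_neg (by omega), if_neg (by omega)] at h1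
      omega
    subst hi4
    have h2 := le_count (replicate_le_block c k _ 2 (by simp; omega)) hA
    rw [hcount 2 (by omega)] at h2
    simp at h1 h2
    omega
  · have h1 := le_count (Multiset.le_add_right _ _) hA
    rw [hcount 1 le_rfl] at h1
    simp at h1
    have hA' := (Multiset.le_add_left _ _).trans hA
    have h2 := le_count (replicate_le_block c k _ i (by simp; omega)) hA'
    have h3 := le_count (replicate_le_block c k _ 2 (by simp; omega)) hA'
    rw [hcount 2 (by omega)] at h3
    rw [hcount i (by omega)] at h2
    simp at h3
    have hi3 : i = 2 ∨ i = 3 := by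
      by_contra hne
      rw [if_neg (by omega), if_neg (by omega), if_neg (by omega)] at h2
      split_ifs at h2 <;> omega
    rcases hi3 with rfl | rfl
    · right; left
      obtain ⟨s', rfl⟩ : ∃ s', s = s' + (c + 1) := ⟨s - (c + 1), by omega⟩
      obtain ⟨a', rfl⟩ : ∃ a', a = a' + c := ⟨a - c, by omega⟩
      exact ⟨s', a', rfl, rfl, (eqC c k s' a' b e).2⟩
    · right; right; left
      simp at h2
      exact ⟨h3, h2⟩
  · left
    have h1 := le_count le_rfl hA
    rw [hcount 1 le_rfl] at h1
    simp at h1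
    obtain ⟨s', rfl⟩ : ∃ s', s = s' + (c + 1) := ⟨s - (c + 1), by omega⟩
    exact ⟨s', rfl, (eqU c k s' a b e).2⟩
  · have h1 := le_count le_rfl hA
    rw [hcount i (by omega)] at h1
    have hi3 : i = 2 ∨ i = 3 := by
      by_contra hne
      rw [if_neg (by omega), if_neg (by omega), if_neg (by omega)] at h1
      split_ifs at h1 <;> omega
    rcases hi3 with rfl | rfl
    · right; right; right; left
      simpa using h1
    · right; right; right; right
      simp at h1
      obtain ⟨b', rfl⟩ : ∃ b', b = b' + (c + 1) := ⟨b - (c + 1), by omega⟩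
      exact ⟨b', rfl, (eqE c k s a b' e).2⟩
  · exfalso
    have h1 := le_count le_rfl hA
    rw [hcount (k + 1) (by omega), if_neg (by omega), if_neg (by omega), if_neg (by omega)] at h1
    split_ifs at h1 <;> omega
  · exfalso
    have h1 := le_count le_rfl hA
    rw [hcount i (by omega), if_neg (by omega), if_neg (by omega), if_neg (by omega),
      if_neg (by omega)] at h1
    omega

/-- Total value outside of the ones. -/
def wt (c a b e : ℕ) : ℕ := (c + 1) * a + (c + 1) ^ 2 * b + (c + 1) ^ 3 * e

/-- The position with total value `n` and prescribed numbers of `S_2`, `S_3`, `S_4`. -/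
def Q (c k n a b e : ℕ) : Multiset ℕ := pos c k (n - wt c a b e) a b e

lemma QU (c k n a b e : ℕ) (h : wt c (a + 1) b e ≤ n) :
    CkMove c k (Q c k n a b e) (Q c k n (a + 1) b e) := by
  have e1 : wt c (a + 1) b e = wt c a b e + (c + 1) := by unfold wt; ring
  have := moveU c k (n - wt c (a + 1) b e) a b e
  rwa [show n - wt c (a + 1) b e + (c + 1) = n - wt c a b e by omega] at this

lemma QC (c k n a b e : ℕ) (hk : 3 ≤ k) (h : wt c a (b + 1) e ≤ n) :
    CkMove c k (Q c k n (a + c) b e) (Q c k n a (b + 1) e) := by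
  have e1 : wt c a (b + 1) e = wt c (a + c) b e + (c + 1) := by unfold wt; ring
  have := moveC c k (n - wt c a (b + 1) e) a b e hk
  rwa [show n - wt c a (b + 1) e + (c + 1) = n - wt c (a + c) b e by omega] at this

lemma QD (c k n a b e : ℕ) (hk : 3 ≤ k) (h : wt c a b (e + 1) ≤ n) :
    CkMove c k (Q c k n (a + c) (b + c) e) (Q c k n a b (e + 1)) := by
  have e1 : wt c a b (e + 1) = wt c (a + c) (b + c) e + (c + 1) := by unfold wt; ring
  have := moveD c k (n - wt c a b (e + 1)) a b e hk
  rwa [show n - wt c a b (e + 1) + (c + 1) = n - wt c (a + c) (b + c) e by omega] at this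

lemma QM (c k n a b e : ℕ) (hk : 3 ≤ k) :
    CkMove c k (Q c k n (a + (c + 1)) b e) (Q c k n a (b + 1) e) := by
  have e1 : wt c a (b + 1) e = wt c (a + (c + 1)) b e := by unfold wt; ring
  have := moveM c k (n - wt c a (b + 1) e) a b e hk
  unfold Q
  rwa [← e1]

lemma QE (c k n a b e : ℕ) (hk : 3 ≤ k) :
    CkMove c k (Q c k n a (b + (c + 1)) e) (Q c k n a b (e + 1)) := by
  have e1 : wt c a b (e + 1) = wt c a (b + (c + 1)) e := by unfold wt; ring
  have := moveE c k (n - wt c a b (e + 1)) a b e hk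
  unfold Q
  rwa [← e1]

lemma Q_cases (c k : ℕ) (hc : 1 ≤ c) (hk : 3 ≤ k) (n a b e : ℕ) (he : e ≤ 1)
    (hae : e = 0 ∨ a = 0) (B : Multiset ℕ) (h : CkMove c k (Q c k n a b e) B) :
    B = Q c k n (a + 1) b e ∨
    (∃ a', a = a' + c ∧ B = Q c k n a' (b + 1) e) ∨
    (c ≤ a ∧ c ≤ b) ∨ (c + 1 ≤ a) ∨
    (∃ b', b = b' + (c + 1) ∧ B = Q c k n a b' (e + 1)) := by
  rcases move_cases c k hc hk _ a b e he hae B h with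
    ⟨s', h1, h2⟩ | ⟨s', a', h1, h2, h3⟩ | h1 | h1 | ⟨b', h1, h2⟩
  · left
    have e1 : wt c (a + 1) b e = wt c a b e + (c + 1) := by unfold wt; ring
    rw [h2, Q, show s' = n - wt c (a + 1) b e by omega]
  · right; left
    refine ⟨a', h2, ?_⟩
    subst h2
    have e1 : wt c a' (b + 1) e = wt c (a' + c) b e + (c + 1) := by unfold wt; ring
    rw [h3, Q, show s' = n - wt c a' (b + 1) e by omega]
  · exact Or.inr (Or.inr (Or.inl h1))
  · exact Or.inr (Or.inr (Or.inr (Or.inl h1)))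
  · right; right; right; right
    refine ⟨b', h1, ?_⟩
    subst h1
    have e1 : wt c a b' (e + 1) = wt c a (b' + (c + 1)) e := by unfold wt; ring
    rw [h2, Q, e1]

section Main


/-- shorthand: next mover wins. -/
def N (c k n a b e : ℕ) : Prop := NWin (CkMove c k) (Q c k n a b e)

/-- shorthand: previous mover wins. -/
def P (c k n a b e : ℕ) : Prop := PWin (CkMove c k) (Q c k n a b e)

lemma wt_le (c n : ℕ) (hn : (c + 1) ^ 3 + (c + 1) ≤ n) (a b : ℕ) (ha : a ≤ c) (hb : b ≤ c) :
    wt c a b 0 ≤ n := by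
  unfold wt
  have h1 : (c + 1) * a ≤ (c + 1) * c := Nat.mul_le_mul_left _ ha
  have h2 : (c + 1) ^ 2 * b ≤ (c + 1) ^ 2 * c := Nat.mul_le_mul_left _ hb
  have h3 : (c + 1) ^ 3 = (c + 1) ^ 2 * c + (c + 1) * c + (c + 1) := by ring
  omega

lemma detPN (c k n : ℕ) (hc : 1 ≤ c) (hk : 3 ≤ k) (a b e : ℕ) : P c k n a b e ∨ N c k n a b e :=
  det _ (fun A B h => move_meas c k hc hk A B h) _

/-- Forced moves. -/
lemma forced (c k n : ℕ) (hc : 1 ≤ c) (hk : 3 ≤ k) (a j : ℕ) (ha : a < c) (hj : j ≤ c)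
    (B : Multiset ℕ) (h : CkMove c k (Q c k n a j 0) B) : B = Q c k n (a + 1) j 0 := by
  rcases Q_cases c k hc hk n a j 0 (by omega) (Or.inl rfl) B h with
    h1 | ⟨a', h1, _⟩ | h1 | h1 | ⟨b', h1, _⟩
  · exact h1
  all_goals omega

lemma back_P (c k n : ℕ) (hc : 1 ≤ c) (hk : 3 ≤ k) (a j : ℕ) (ha : a < c) (hj : j ≤ c)
    (h : N c k n (a + 1) j 0) : P c k n a j 0 := by
  intro B hB
  rw [forced c k n hc hk a j ha hj B hB]
  exact h

lemma back_N (c k n : ℕ) (hn : (c + 1) ^ 3 + (c + 1) ≤ n) (a j : ℕ)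
    (ha : a < c) (hj : j ≤ c) (h : P c k n (a + 1) j 0) : N c k n a j 0 :=
  NWin.mk _ _ (QU c k n a j 0 (wt_le c n hn _ _ (by omega) hj)) h

lemma chain_N (c k n : ℕ) (hc : 1 ≤ c) (hk : 3 ≤ k) (hn : (c + 1) ^ 3 + (c + 1) ≤ n) (j : ℕ)
    (hj : j ≤ c) (h : N c k n c j 0) (d : ℕ) (hd : d ≤ c) :
    (Even d → N c k n (c - d) j 0) ∧ (Odd d → P c k n (c - d) j 0) := by
  induction d with
  | zero => exact ⟨fun _ => h, fun h => by simp at h⟩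
  | succ d ih =>
    have ih := ih (by omega)
    rw [show c - d = c - (d + 1) + 1 by omega] at ih
    refine ⟨fun he => ?_, fun ho => ?_⟩
    · exact back_N c k n hn _ j (by omega) hj (ih.2 (by grind))
    · exact back_P c k n hc hk _ j (by omega) hj (ih.1 (by grind))

lemma chain_P (c k n : ℕ) (hc : 1 ≤ c) (hk : 3 ≤ k) (hn : (c + 1) ^ 3 + (c + 1) ≤ n) (j : ℕ)
    (hj : j ≤ c) (h : P c k n c j 0) (d : ℕ) (hd : d ≤ c) :
    (Even d → P c k n (c - d) j 0) ∧ (Odd d → N c k n (c - d) j 0) := by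
  induction d with
  | zero => exact ⟨fun _ => h, fun h => by simp at h⟩
  | succ d ih =>
    have ih := ih (by omega)
    rw [show c - d = c - (d + 1) + 1 by omega] at ih
    refine ⟨fun he => ?_, fun ho => ?_⟩
    · exact back_P c k n hc hk _ j (by omega) hj (ih.2 (by grind))
    · exact back_N c k n hn _ j (by omega) hj (ih.1 (by grind))

/-- `(c, c)` is a win for the mover. -/
lemma top_N (c k n : ℕ) (hc : 1 ≤ c) (hk : 3 ≤ k) (hn : (c + 1) ^ 3 + (c + 1) ≤ n) :
    N c k n c c 0 := by
  rcases detPN c k n hc hk 0 0 1 with hW | hW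
  · refine NWin.mk _ _ ?_ hW
    have := QD c k n 0 0 0 hk (by simp [wt]; omega)
    simpa using this
  · have hW1 : P c k n 1 0 1 := by
      cases id hW with
      | mk _ B hB hP =>
        rcases Q_cases c k hc hk n 0 0 1 le_rfl (Or.inr rfl) B hB with
          h1 | ⟨a', h1, _⟩ | h1 | h1 | ⟨b', h1, _⟩
        · rw [h1] at hP; exact hP
        all_goals omega
    have hX : P c k n 0 (c + 1) 0 := by
      intro B hB
      rcases Q_cases c k hc hk n 0 (c + 1) 0 (by omega) (Or.inl rfl) B hB with
        h1 | ⟨a', h1, _⟩ | h1 | h1 | ⟨b', h1, h2⟩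
      · rw [h1]
        refine NWin.mk _ _ ?_ hW1
        have := QE c k n 1 0 0 hk
        simpa using this
      · omega
      · omega
      · omega
      · obtain rfl : b' = 0 := by omega
        rw [h2]; exact hW
    refine NWin.mk _ _ ?_ hX
    have := QC c k n 0 c 0 hk (by
      have : (c + 1) ^ 3 = (c + 1) ^ 2 * (c + 1) := by ring
      simp only [wt]; omega)
    simpa using this

lemma step_N (c k n : ℕ) (hk : 3 ≤ k) (hn : (c + 1) ^ 3 + (c + 1) ≤ n) (j : ℕ)
    (hj : j < c) (h : P c k n 0 (j + 1) 0) : N c k n c j 0 := by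
  refine NWin.mk _ _ ?_ h
  have := QC c k n 0 j 0 hk (wt_le c n hn _ _ (by omega) (by omega))
  simpa using this

/-- `(c + 1, j)` is a win for the mover. -/
lemma B_N (c k n : ℕ) (hc : 1 ≤ c) (hk : 3 ≤ k) (hn : (c + 1) ^ 3 + (c + 1) ≤ n) (j : ℕ)
    (hj : j < c) : N c k n (c + 1) j 0 := by
  rcases detPN c k n hc hk 0 (j + 1) 0 with h | h
  · refine NWin.mk _ _ ?_ h
    have := QM c k n 0 j 0 hk
    simpa using this
  · cases id h with
    | mk _ B hB hP =>
      rw [forced c k n hc hk 0 (j + 1) (by omega) (by omega) B hB] at hP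
      refine NWin.mk _ _ ?_ hP
      have := QC c k n 1 j 0 hk (wt_le c n hn _ _ (by omega) (by omega))
      simpa [add_comm] using this

lemma step_P (c k n : ℕ) (hc : 1 ≤ c) (hk : 3 ≤ k) (hn : (c + 1) ^ 3 + (c + 1) ≤ n) (j : ℕ)
    (hj : j < c) (h : N c k n 0 (j + 1) 0) : P c k n c j 0 := by
  intro B hB
  rcases Q_cases c k hc hk n c j 0 (by omega) (Or.inl rfl) B hB with
    h1 | ⟨a', h1, h2⟩ | h1 | h1 | ⟨b', h1, _⟩
  · rw [h1]; exact B_N c k n hc hk hn j hj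
  · obtain rfl : a' = 0 := by omega
    rw [h2]; exact h
  all_goals omega

lemma odd_case (c k n : ℕ) (hc : 1 ≤ c) (hk : 3 ≤ k) (hn : (c + 1) ^ 3 + (c + 1) ≤ n)
    (ho : Odd c) : P c k n 0 0 0 := by
  have key : ∀ d ≤ c, N c k n c (c - d) 0 := by
    intro d
    induction d with
    | zero => exact fun _ => top_N c k n hc hk hn
    | succ d ih =>
      intro hd
      have h1 := (chain_N c k n hc hk hn _ (by omega) (ih (by omega)) c le_rfl).2 ho
      rw [Nat.sub_self, show c - d = c - (d + 1) + 1 by omega] at h1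
      exact step_N c k n hk hn _ (by omega) h1
  have h0 := key c le_rfl
  rw [Nat.sub_self] at h0
  have h1 := (chain_N c k n hc hk hn 0 (by omega) h0 c le_rfl).2 ho
  rwa [Nat.sub_self] at h1

lemma even_case (c k n : ℕ) (hc : 1 ≤ c) (hk : 3 ≤ k) (hn : (c + 1) ^ 3 + (c + 1) ≤ n)
    (he : Even c) : N c k n 0 0 0 := by
  have key : ∀ d ≤ c, (Even d → N c k n c (c - d) 0) ∧ (Odd d → P c k n c (c - d) 0) := by
    intro d
    induction d with
    | zero => exact fun _ => ⟨fun _ => top_N c k n hc hk hn, fun h => by simp at h⟩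
    | succ d ih =>
      intro hd
      have ih := ih (by omega)
      refine ⟨fun h => ?_, fun h => ?_⟩
      · have h1 := (chain_P c k n hc hk hn _ (by omega) (ih.2 (by grind)) c le_rfl).1 he
        rw [Nat.sub_self, show c - d = c - (d + 1) + 1 by omega] at h1
        exact step_N c k n hk hn _ (by omega) h1
      · have h1 := (chain_N c k n hc hk hn _ (by omega) (ih.1 (by grind)) c le_rfl).1 he
        rw [Nat.sub_self, show c - d = c - (d + 1) + 1 by omega] at h1
        exact step_P c k n hc hk hn _ (by omega) h1
  have h0 := (key c le_rfl).1 he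
  rw [Nat.sub_self] at h0
  have h1 := (chain_N c k n hc hk hn 0 (by omega) h0 c le_rfl).1 he
  rwa [Nat.sub_self] at h1

lemma start (c k n : ℕ) : Q c k n 0 0 0 = replicate n 1 := by
  simp [Q, pos, wt, nacci_one]

end Main

end CkGame

/-- In the two-player `(c,k)`-nacci Zeckendorf game on `n`, for every `c ≥ 1`, every
`k ≥ 3`, and every `n ≥ (c+1)³ + (c+1)`: if `c` is odd then Player 2 has a winning
strategy, and if `c` is even then Player 1 has a winning strategy. -/
theorem two_player_ck_nacci_winner_k_ge_three (c k n : ℕ) (hc : 1 ≤ c) (hk : 3 ≤ k)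
    (hn : (c + 1) ^ 3 + (c + 1) ≤ n) :
    (Odd c → PlayerWins (CkMove c k) 2 2 n) ∧ (Even c → PlayerWins (CkMove c k) 2 1 n) := by
  refine ⟨fun ho => ?_, fun he => ?_⟩
  · have h := CkGame.odd_case c k n hc hk hn ho
    unfold PlayerWins
    rw [← CkGame.start c k n]
    refine AllianceWins.oppMove 0 _ (by simp) ⟨_, CkGame.QU c k n 0 0 0 ?_⟩ ?_
    · exact CkGame.wt_le c n hn _ _ (by omega) (by omega)
    · intro B hB
      exact CkGame.alliance _ 2 (Or.inr rfl) B (h B hB) 1 (by norm_num)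
  · have h := CkGame.even_case c k n hc hk hn he
    unfold PlayerWins
    rw [← CkGame.start c k n]
    exact CkGame.alliance _ 1 (Or.inl rfl) _ h 0 (by norm_num)
end
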